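/- arXiv:2508.08085 — 3 statements merged into one kernel-verified Lean document; each statement's English description precedes it below -/
import Mathlib

section
/- Kernel-form product formula for two associated Legendre functions of the first kind. Let ν, μ ∈ ℂ with Re(ν+μ) > −3 and such that ν+1 is not a nonpositive integer, and let z₁, z₂ be real numbers with z₁ > 1 and z₂ > 1. For z₃ ∈ (1, (1+z₁z₂)/(z₁+z₂)) set C := (1 − z₁²z₂² − z₁²z₃² − z₂²z₃² + 2 z₁²z₂²z₃²)/(2 z₁ z₂ z₃ √((z₁²−1)(z₂²−1)(z₃²−1))) (note C > 1 on this range). Assume that the function z₃ ↦ P_ν^{−μ}(z₃) · (C−1)^{−ν−1} · z₃^{−ν−1} · (1−z₃²)^{−1} is absolutely integrable on (1, (1+z₁z₂)/(z₁+z₂)). Then P_ν^{−μ}(z₁) · P_ν^{−μ}(z₂) = [sin(πν) Γ(ν+1)] / [π Γ(ν+μ+1) (z₁z₂)^{ν+1}] × ∫_1^{(1+z₁z₂)/(z₁+z₂)} P_ν^{−μ}(z₃) · (C−1)^{−ν−1} / (z₃^{ν+1} (1−z₃²)) dz₃. -/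
open MeasureTheory Set

/-- The regularized Gauss hypergeometric function `₂F̃₁(a,b;c;z)`. -/
noncomputable def hyp2F1reg (a b c z : ℂ) : ℂ :=
  ∑' n : ℕ, (ascPochhammer ℂ n).eval a * (ascPochhammer ℂ n).eval b /
      (Complex.Gamma (c + n) * (n.factorial : ℂ)) * z ^ n

/-- The Jacobi function of the second kind `Q_γ^{(α,β)}(z)` for real `z > 1`. -/
noncomputable def jacobiQ (α β γ : ℂ) (z : ℝ) : ℂ :=
  (2 : ℂ) ^ (α + β + γ) * Complex.Gamma (α + γ + 1) * Complex.Gamma (β + γ + 1) *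
    ((z : ℂ) - 1) ^ (-α) * ((z : ℂ) + 1) ^ (-β - γ - 1) *
    hyp2F1reg (γ + 1) (β + γ + 1) (α + β + 2 * γ + 2) (2 / (1 + (z : ℂ)))

/-- The Jacobi function of the first kind `P_γ^{(α,β)}(z)` for real `z > 1`. -/
noncomputable def jacobiP (α β γ : ℂ) (z : ℝ) : ℂ :=
  Complex.Gamma (α + γ + 1) / Complex.Gamma (γ + 1) * (((z : ℂ) + 1) / 2) ^ γ *
    hyp2F1reg (-γ) (-β - γ) (α + 1) (((z : ℂ) - 1) / ((z : ℂ) + 1))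

/-- The Jacobi function of the first kind on the cut `𝖯_γ^{(α,β)}(x)`, `x ∈ (−1,1)`. -/
noncomputable def jacobiPcut (α β γ : ℂ) (x : ℝ) : ℂ :=
  Complex.Gamma (α + γ + 1) / Complex.Gamma (γ + 1) *
    hyp2F1reg (-γ) (α + β + γ + 1) (α + 1) ((1 - (x : ℂ)) / 2)

/-- The Gegenbauer function of the first kind `C_λ^α(z)` for real `z > 1`. -/
noncomputable def gegenbauerC (lam α : ℂ) (z : ℝ) : ℂ :=
  (Real.sqrt Real.pi : ℂ) * Complex.Gamma (lam + 2 * α) /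
      ((2 : ℂ) ^ (2 * α - 1) * Complex.Gamma α * Complex.Gamma (lam + 1)) *
    (((z : ℂ) + 1) / 2) ^ lam *
    hyp2F1reg (-lam) (1 / 2 - α - lam) (α + 1 / 2) (((z : ℂ) - 1) / ((z : ℂ) + 1))

/-- The Gegenbauer function of the first kind on the cut `𝖢_λ^α(x)`, `x ∈ (−1,1)`. -/
noncomputable def gegenbauerCcut (lam α : ℂ) (x : ℝ) : ℂ :=
  (Real.sqrt Real.pi : ℂ) * Complex.Gamma (lam + 2 * α) /
      ((2 : ℂ) ^ (2 * α - 1) * Complex.Gamma α * Complex.Gamma (lam + 1)) *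
    hyp2F1reg (-lam) (lam + 2 * α) (α + 1 / 2) ((1 - (x : ℂ)) / 2)

/-- The Gegenbauer function of the second kind `D_λ^α(z)` for real `z > 1`. -/
noncomputable def gegenbauerD (lam α : ℂ) (z : ℝ) : ℂ :=
  Complex.exp ((Real.pi : ℂ) * Complex.I * α) * (Complex.Gamma (lam + 2 * α) / Complex.Gamma α) *
    (2 * (z : ℂ)) ^ (-lam - 2 * α) *
    hyp2F1reg (lam / 2 + α) (lam / 2 + α + 1 / 2) (lam + α + 1) (1 / (z : ℂ) ^ 2)

/-- The associated Legendre function of the second kind `Q_ν^μ(z)` for real `z > 1`. -/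
noncomputable def legendreQ (ν μ : ℂ) (z : ℝ) : ℂ :=
  (Real.sqrt Real.pi : ℂ) * Complex.exp ((Real.pi : ℂ) * Complex.I * μ) *
    Complex.Gamma (ν + μ + 1) * ((z : ℂ) ^ 2 - 1) ^ (μ / 2) * (2 : ℂ) ^ (-ν - 1) *
    (z : ℂ) ^ (-ν - μ - 1) *
    hyp2F1reg ((ν + μ + 1) / 2) ((ν + μ + 2) / 2) (ν + 3 / 2) (1 / (z : ℂ) ^ 2)

/-- The Legendre function of the first kind `P_ν(z)` for real `z ≥ 1`. -/
noncomputable def legendreP (ν : ℂ) (z : ℝ) : ℂ :=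
  (((z : ℂ) + 1) / 2) ^ ν * hyp2F1reg (-ν) (-ν) 1 (((z : ℂ) - 1) / ((z : ℂ) + 1))

/-- The associated Legendre function of the first kind of order `−μ`, `P_ν^{−μ}(z)`, `z > 1`. -/
noncomputable def legendrePa (ν μ : ℂ) (z : ℝ) : ℂ :=
  (((z : ℂ) - 1) / ((z : ℂ) + 1)) ^ (μ / 2) * (((z : ℂ) + 1) / 2) ^ ν *
    hyp2F1reg (-ν) (μ - ν) (μ + 1) (((z : ℂ) - 1) / ((z : ℂ) + 1))

/-- The Ferrers function of the first kind of order `−μ`, `𝖯_ν^{−μ}(x)`, `x ∈ (−1,1)`. -/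
noncomputable def ferrersP (ν μ : ℂ) (x : ℝ) : ℂ :=
  ((1 - (x : ℂ)) / (1 + (x : ℂ))) ^ (μ / 2) * hyp2F1reg (-ν) (ν + 1) (1 + μ) ((1 - (x : ℂ)) / 2)

/-- The Ferrers function of the second kind of order `−μ`, `𝖰_ν^{−μ}(x)`, `x ∈ (−1,1)`. -/
noncomputable def ferrersQ (ν μ : ℂ) (x : ℝ) : ℂ :=
  -((Real.pi : ℂ) / (2 * Complex.sin ((Real.pi : ℂ) * μ))) *
    (Complex.cos ((Real.pi : ℂ) * (ν - μ)) *
        (Complex.Gamma (ν - μ + 1) / Complex.Gamma (ν + μ + 1)) *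
        ((1 + (x : ℂ)) / (1 - (x : ℂ))) ^ (-μ / 2) *
        hyp2F1reg (-ν) (ν + 1) (1 - μ) ((1 + (x : ℂ)) / 2) -
      Complex.cos ((Real.pi : ℂ) * ν) * ((1 - (x : ℂ)) / (1 + (x : ℂ))) ^ (-μ / 2) *
        hyp2F1reg (-ν) (ν + 1) (1 + μ) ((1 + (x : ℂ)) / 2))

/-- Pochhammer symbol. -/
noncomputable def lpPoch (a : ℂ) (n : ℕ) : ℂ := (ascPochhammer ℂ n).eval a

/-- Reciprocal Gamma function. -/
noncomputable def lpRG (s : ℂ) : ℂ := (Complex.Gamma s)⁻¹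

lemma lpPoch_zero (a : ℂ) : lpPoch a 0 = 1 := by simp [lpPoch]

lemma lpPoch_succ (a : ℂ) (n : ℕ) : lpPoch a (n + 1) = lpPoch a n * (a + n) := by
  simp [lpPoch, ascPochhammer_succ_eval]

lemma lpPoch_succ_left (a : ℂ) (n : ℕ) : lpPoch a (n + 1) = a * lpPoch (a + 1) n := by
  induction n with
  | zero => simp [lpPoch]
  | succ n ih => rw [lpPoch_succ, ih, lpPoch_succ]; push_cast; ring

lemma lpRG_rec (s : ℂ) : lpRG s = s * lpRG (s + 1) :=
  Complex.one_div_Gamma_eq_self_mul_one_div_Gamma_add_one s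

lemma lpRG_continuous : Continuous lpRG := Complex.differentiable_one_div_Gamma.continuous

lemma lpPoch_continuous (n : ℕ) : Continuous fun a => lpPoch a n := by
  unfold lpPoch
  exact (ascPochhammer ℂ n).continuous

/-- Coefficients of the regularized hypergeometric series. -/
noncomputable def lpG (a b c : ℂ) (n : ℕ) : ℂ :=
  lpPoch a n * lpPoch b n * lpRG (c + n) / (n.factorial : ℂ)

lemma lpG_rec (a b c : ℂ) (n : ℕ) :
    ((n : ℂ) + 1) * (c + n) * lpG a b c (n + 1) = (a + n) * (b + n) * lpG a b c n := by
  unfold lpG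
  rw [lpPoch_succ, lpPoch_succ, Nat.factorial_succ, lpRG_rec (c + n)]
  have h1 : ((n : ℂ) + 1) ≠ 0 := Nat.cast_add_one_ne_zero n
  have h2 : (n.factorial : ℂ) ≠ 0 := by exact_mod_cast n.factorial_ne_zero
  push_cast
  rw [← add_assoc]
  field_simp

/-- The moments. -/
noncomputable def lpL (a c : ℂ) (N : ℕ) : ℂ := lpPoch a N * lpRG (c + N)

lemma lpL_rec (a c : ℂ) (n : ℕ) : (c + n) * lpL a c (n + 1) = (a + n) * lpL a c n := by
  unfold lpL
  rw [lpPoch_succ, lpRG_rec (c + n)]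
  push_cast
  rw [← add_assoc]
  ring

/-- Coefficients of the binomial series `(1-x)^(-a)`. -/
noncomputable def lpT (a : ℂ) (n : ℕ) : ℂ := lpPoch a n / (n.factorial : ℂ)

lemma lpT_rec (a : ℂ) (n : ℕ) : ((n : ℂ) + 1) * lpT a (n + 1) = (a + n) * lpT a n := by
  unfold lpT
  rw [lpPoch_succ, Nat.factorial_succ]
  have h1 : ((n : ℂ) + 1) ≠ 0 := Nat.cast_add_one_ne_zero n
  have h2 : (n.factorial : ℂ) ≠ 0 := by exact_mod_cast n.factorial_ne_zero
  push_cast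
  field_simp

/-- Zero extension of `lpT` to the integers. -/
noncomputable def lpTz (a : ℂ) (i : ℤ) : ℂ := if 0 ≤ i then lpT a i.toNat else 0

lemma lpTz_neg (a : ℂ) {i : ℤ} (h : i < 0) : lpTz a i = 0 := by simp [lpTz, h]

lemma lpTz_nat (a : ℂ) (i : ℕ) : lpTz a i = lpT a i := by simp [lpTz]

lemma lpTz_rec (a : ℂ) (i : ℤ) : (i : ℂ) * lpTz a i = (i - 1 + a) * lpTz a (i - 1) := by
  rcases lt_trichotomy i 0 with h | h | h
  · rw [lpTz_neg a h, lpTz_neg a (by omega)]; simp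
  · subst h; rw [lpTz_neg a (i := 0 - 1) (by omega)]; simp
  · obtain ⟨n, rfl⟩ : ∃ n : ℕ, i = n + 1 := ⟨(i - 1).toNat, by omega⟩
    have := lpT_rec a n
    rw [show ((n : ℤ) + 1 - 1) = (n : ℤ) by ring, lpTz_nat,
      show ((n : ℤ) + 1) = ((n + 1 : ℕ) : ℤ) by push_cast; ring, lpTz_nat]
    push_cast
    rw [this]; ring

/-- The inner sums. -/
noncomputable def lpB (α μ : ℂ) (S : ℕ) (n k l : ℤ) : ℂ :=
  ∑ m ∈ Finset.range S, lpTz (1 - α) (k - n - m) * lpTz (1 - α) (l - n - m) * lpTz (1 - α) m *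
    lpL (μ + 1 - α) (μ + 1) (k + l - m).toNat

lemma lpB_zero (α μ : ℂ) (S : ℕ) (n k l : ℤ) (h : k < n) : lpB α μ S n k l = 0 := by
  unfold lpB
  refine Finset.sum_eq_zero fun m _ => ?_
  rw [lpTz_neg _ (i := k - n - m) (by omega)]; simp

lemma lpB_rel (α μ : ℂ) (S : ℕ) (n k l : ℤ) (hn : 0 ≤ n) (hl : 0 ≤ l) (hS : k - n < S) :
    (k - n) * (k + n + μ) * lpB α μ S n k l
      - (k - n - α) * (k + n + α + μ) * lpB α μ S (n + 1) k l
      - (k - n - α) * (k + n + μ - α) * lpB α μ S n (k - 1) l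
      + (k - n - 2 * α) * (k + n + μ) * lpB α μ S (n + 1) (k - 1) l = 0 := by
  set t := lpTz (1 - α) with ht
  set La : ℤ → ℂ := fun M => lpL (μ + 1 - α) (μ + 1) M.toNat with hLa
  let G : ℕ → ℂ := fun m => -(k + n + μ) * m * t m * La (k + l - m) * t (l - n - m) *
    (t (k - n - m) - t (k - n - m - 1))
  have key : ∀ m : ℕ, 
      (k - n) * (k + n + μ) * (t (k - n - m) * t (l - n - m) * t m * La (k + l - m))
      - (k - n - α) * (k + n + α + μ) *
        (t (k - (n + 1) - m) * t (l - (n + 1) - m) * t m * La (k + l - m))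
      - (k - n - α) * (k + n + μ - α) *
        (t (k - 1 - n - m) * t (l - n - m) * t m * La (k - 1 + l - m))
      + (k - n - 2 * α) * (k + n + μ) *
        (t (k - 1 - (n + 1) - m) * t (l - (n + 1) - m) * t m * La (k - 1 + l - m))
      = G (m + 1) - G m := by
    intro m
    simp only [G]
    have e1 : k - (n + 1) - m = k - n - m - 1 := by ring
    have e2 : l - (n + 1) - m = l - n - m - 1 := by ring
    have e3 : k - 1 - n - m = k - n - m - 1 := by ring
    have e4 : k - 1 - (n + 1) - m = k - n - m - 1 - 1 := by ring
    have e5 : k - 1 + l - m = k + l - m - 1 := by ring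
    have e6 : k + l - ((m + 1 : ℕ) : ℤ) = k + l - m - 1 := by push_cast; ring
    have e7 : l - n - ((m + 1 : ℕ) : ℤ) = l - n - m - 1 := by push_cast; ring
    have e8 : k - n - ((m + 1 : ℕ) : ℤ) = k - n - m - 1 := by push_cast; ring
    rw [e1, e2, e3, e4, e5, e6, e7, e8]
    have r1 := lpTz_rec (1 - α) (k - n - m)
    have r2 := lpTz_rec (1 - α) (k - n - m - 1)
    have r3 := lpTz_rec (1 - α) (l - n - m)
    have r4 := lpTz_rec (1 - α) ((m + 1 : ℕ) : ℤ)
    rw [show ((m + 1 : ℕ) : ℤ) - 1 = m by push_cast; ring] at r4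
    rw [← ht] at r1 r2 r3 r4
    have r5 : t (k - n - m - 1) * ((μ + k + l - m) * La (k + l - m)) =
        t (k - n - m - 1) * ((μ - α + k + l - m) * La (k + l - m - 1)) := by
      by_cases h : k - n - m - 1 < 0
      · rw [ht, lpTz_neg _ h]; simp
      · obtain ⟨p, hp⟩ : ∃ p : ℕ, k + l - m - 1 = p := ⟨(k + l - m - 1).toNat, by omega⟩
        have hp' : k + l - m = p + 1 := by omega
        have hc : (k : ℂ) + l - m = p + 1 := by exact_mod_cast congrArg (Int.cast (R := ℂ)) hp'
        simp only [hLa]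
        rw [hp, hp', show ((p : ℤ) + 1).toNat = p + 1 by omega, show ((p : ℤ)).toNat = p by omega]
        have := lpL_rec (μ + 1 - α) (μ + 1) p
        congr 1
        linear_combination this + (lpL (μ + 1 - α) (μ + 1) (p + 1)
           - lpL (μ + 1 - α) (μ + 1) p) * hc
    push_cast at r1 r2 r3 r4 ⊢
    generalize t (k - n - m) = ti at *
    generalize t (k - n - m - 1) = t1 at *
    generalize t (k - n - m - 1 - 1) = t2 at *
    generalize t (l - n - m) = s at *
    generalize t (l - n - m - 1) = s1 at *
    generalize La (k + l - m) = L0 at *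
    generalize La (k + l - m - 1) = L1 at *
    generalize t (m : ℤ) = tm at *
    generalize t ((m : ℤ) + 1) = tm' at *
    linear_combination (k + n + μ) * s * L0 * tm * r1 - (k + n + μ) * s1 * L1 * tm * r2
      + (k + n + μ) * L1 * s1 * (t1 - t2) * r4
      + (k - n - α) * t1 * tm * (L1 - L0) * r3 + (k - n - α) * tm * (s - s1) * r5
  have hsum := Finset.sum_range_sub G S
  rw [← Finset.sum_congr rfl fun m _ => key m] at hsum
  have hG0 : G 0 = 0 := by simp [G]
  have hGS : G S = 0 := by
    simp only [G]
    rw [ht, lpTz_neg _ (i := k - n - S) (by omega), lpTz_neg _ (i := k - n - S - 1) (by omega)]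
    simp
  rw [hG0, hGS, sub_zero, Finset.sum_add_distrib, Finset.sum_sub_distrib, Finset.sum_sub_distrib,
    ← Finset.mul_sum, ← Finset.mul_sum, ← Finset.mul_sum, ← Finset.mul_sum] at hsum
  exact hsum

/-- Coefficients of the double series. -/
noncomputable def lpC (α μ : ℂ) (S : ℕ) (k l : ℤ) : ℂ :=
  ∑ n ∈ Finset.range S, lpG α (α + μ) (μ + 1) n * (lpB α μ S n k l - lpB α μ S (n + 1) k l)

lemma lpC_rec (α μ : ℂ) (S : ℕ) (k l : ℤ) (hl : 0 ≤ l) (hS : k < S) :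
    k * (k + μ) * lpC α μ S k l = (k - α) * (k + μ - α) * lpC α μ S (k - 1) l := by
  let P : ℕ → ℂ := fun n => n * (n + μ) * lpG α (α + μ) (μ + 1) n *
    (lpB α μ S n k l - lpB α μ S n (k - 1) l)
  have hs := Finset.sum_range_sub' P S
  have h0 : P 0 = 0 := by simp [P]
  have hPS : P S = 0 := by
    simp only [P]
    rw [lpB_zero _ _ _ _ _ _ hS, lpB_zero _ _ _ _ _ _ (by omega)]; simp
  rw [h0, hPS] at hs
  unfold lpC
  rw [← sub_eq_zero, Finset.mul_sum, Finset.mul_sum, ← Finset.sum_sub_distrib]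
  rw [← sub_eq_zero.mpr (rfl : (0:ℂ) = 0), ← hs]
  refine Finset.sum_congr rfl fun n _ => ?_
  simp only [P]
  have h1 := lpB_rel α μ S n k l (by omega) hl (by omega)
  have h2 := lpG_rec α (α + μ) (μ + 1) n
  push_cast at h1 ⊢
  linear_combination (lpG α (α + μ) (μ + 1) n) * h1 +
    (lpB α μ S (n+1) k l - lpB α μ S (n+1) (k - 1) l) * h2

lemma lpC_base (α μ : ℂ) (S l : ℕ) (hS : 0 < S) :
    lpC α μ S 0 l = lpG (1 - α) (μ + 1 - α) (μ + 1) 0 * lpG (1 - α) (μ + 1 - α) (μ + 1) l := by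
  unfold lpC
  rw [Finset.sum_eq_single_of_mem 0 (Finset.mem_range.mpr hS)]
  · rw [lpB_zero _ _ _ (_ + 1) _ _ (by simp)]
    unfold lpB
    rw [Finset.sum_eq_single_of_mem 0 (Finset.mem_range.mpr hS)]
    · have h0 := lpTz_nat (1 - α) 0
      simp only [Nat.cast_zero] at h0
      simp only [Nat.cast_zero, sub_zero, zero_add, lpTz_nat, Int.toNat_natCast, h0]
      simp only [lpT, lpL, lpG, lpPoch_zero, Nat.factorial_zero, Nat.cast_one, Nat.cast_zero, add_zero]
      ring
    · intro m _ hm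
      rw [lpTz_neg _ (i := 0 - _ - _) (by omega)]; simp
  · intro n _ hn
    rw [lpB_zero _ _ _ _ _ _ (by omega), lpB_zero _ _ _ _ _ _ (by omega)]; simp

lemma lpC_eq_generic (α μ : ℂ) (hμ : ∀ n : ℕ, μ + 1 + n ≠ 0) (S k l : ℕ) (hS : k < S) :
    lpC α μ S k l = lpG (1 - α) (μ + 1 - α) (μ + 1) k * lpG (1 - α) (μ + 1 - α) (μ + 1) l := by
  induction k with
  | zero => exact lpC_base α μ S l hS
  | succ k ih =>
    have ih := ih (by omega)
    have h := lpC_rec α μ S ((k + 1 : ℕ) : ℤ) l (by omega) (by omega)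
    rw [show (((k + 1 : ℕ) : ℤ) - 1) = (k : ℤ) by push_cast; ring, ih] at h
    have h2 := lpG_rec (1 - α) (μ + 1 - α) (μ + 1) k
    have h1 : ((k : ℂ) + 1) ≠ 0 := Nat.cast_add_one_ne_zero k
    have h3 : ((k : ℂ) + 1) * (μ + 1 + k) ≠ 0 := mul_ne_zero h1 (hμ k)
    apply mul_left_cancel₀ h3
    push_cast at h ⊢
    linear_combination h - lpG (1 - α) (μ + 1 - α) (μ + 1) l * h2

lemma lp_dense : Dense {μ : ℂ | ∀ n : ℕ, μ + 1 + n ≠ 0} := by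
  have : {μ : ℂ | ∀ n : ℕ, μ + 1 + n ≠ 0} = (Set.range fun n : ℕ => (-1 - n : ℂ))ᶜ := by
    ext μ
    simp only [Set.mem_ofPred_eq, Set.mem_compl_iff, Set.mem_range, not_exists]
    refine forall_congr' fun n => not_congr ⟨fun h => by linear_combination -h, fun h => by
      linear_combination -h⟩
  rw [this]
  exact (Set.countable_range _).dense_compl ℝ

lemma lpG_continuous (a b c : ℂ → ℂ) (ha : Continuous a) (hb : Continuous b) (hc : Continuous c)
    (n : ℕ) : Continuous fun μ => lpG (a μ) (b μ) (c μ) n := by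
  unfold lpG
  exact ((((lpPoch_continuous n).comp ha).mul ((lpPoch_continuous n).comp hb)).mul
    (lpRG_continuous.comp (hc.add continuous_const))).div_const _

lemma lpC_eq (α μ : ℂ) (S k l : ℕ) (hS : k < S) :
    lpC α μ S k l = lpG (1 - α) (μ + 1 - α) (μ + 1) k * lpG (1 - α) (μ + 1 - α) (μ + 1) l := by
  have hB : ∀ n k l : ℤ, Continuous fun μ => lpB α μ S n k l := by
    intro n k l
    unfold lpB lpL
    refine continuous_finsetSum _ fun m _ => continuous_const.mul ?_
    exact ((lpPoch_continuous _).comp (by fun_prop)).mul (lpRG_continuous.comp (by fun_prop))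
  have h1 : Continuous fun μ => lpC α μ S k l := by
    unfold lpC
    refine continuous_finsetSum _ fun n _ => ?_
    exact (lpG_continuous _ _ _ (by fun_prop) (by fun_prop) (by fun_prop) n).mul
      ((hB _ _ _).sub (hB _ _ _))
  have h2 : Continuous fun μ => lpG (1 - α) (μ + 1 - α) (μ + 1) k *
      lpG (1 - α) (μ + 1 - α) (μ + 1) l :=
    (lpG_continuous _ _ _ (by fun_prop) (by fun_prop) (by fun_prop) k).mul
      (lpG_continuous _ _ _ (by fun_prop) (by fun_prop) (by fun_prop) l)
  exact congrFun (Continuous.ext_on lp_dense h1 h2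
    (fun μ hμ => lpC_eq_generic α μ hμ S k l hS)) μ

/-- Euler transformation, coefficient form. -/
lemma lp_euler (α μ : ℂ) (n : ℕ) :
    ∑ p ∈ Finset.HasAntidiagonal.antidiagonal n, lpT (2 * α - 1) p.1 * lpG (1 - α) (μ + 1 - α) (μ + 1) p.2 =
      lpG α (α + μ) (μ + 1) n := by
  have hgen : ∀ μ ∈ {μ : ℂ | ∀ n : ℕ, μ + 1 + n ≠ 0},
      ∑ p ∈ Finset.HasAntidiagonal.antidiagonal n, lpT (2 * α - 1) p.1 * lpG (1 - α) (μ + 1 - α) (μ + 1) p.2 =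
      lpG α (α + μ) (μ + 1) n := by
    intro μ hμ
    induction n with
    | zero => simp [lpT, lpG, lpPoch_zero]
    | succ n ih =>
      have h1 : ((n : ℂ) + 1) ≠ 0 := Nat.cast_add_one_ne_zero n
      have h3 : ((n : ℂ) + 1) * (μ + 1 + n) ≠ 0 := mul_ne_zero h1 (hμ n)
      apply mul_left_cancel₀ h3
      rw [lpG_rec, ← ih]
      set q := lpT (2 * α - 1)
      set g := lpG (1 - α) (μ + 1 - α) (μ + 1)
      have e1 : ((n : ℂ) + 1) * (μ + 1 + n) * ∑ p ∈ Finset.HasAntidiagonal.antidiagonal (n + 1), q p.1 * g p.2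
          = ∑ p ∈ Finset.HasAntidiagonal.antidiagonal (n + 1), q p.1 * (p.2 * (p.2 + μ) * g p.2)
          + ∑ p ∈ Finset.HasAntidiagonal.antidiagonal (n + 1), (p.1 * q p.1) * ((n + 1 + p.2 + μ) * g p.2) := by
        rw [Finset.mul_sum, ← Finset.sum_add_distrib]
        refine Finset.sum_congr rfl fun p hp => ?_
        have : (p.1 : ℂ) + p.2 = n + 1 := by exact_mod_cast Finset.HasAntidiagonal.mem_antidiagonal.mp hp
        linear_combination (-(n + 1 + p.2 + μ)) * (q p.1 * g p.2) * this
      rw [e1, Finset.Nat.sum_antidiagonal_succ', Finset.Nat.sum_antidiagonal_succ, Finset.mul_sum]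
      simp only [Nat.cast_zero, zero_mul, mul_zero, add_zero, zero_add]
      rw [← Finset.sum_add_distrib]
      refine Finset.sum_congr rfl fun p hp => ?_
      have hp : (p.1 : ℂ) + p.2 = n := by exact_mod_cast Finset.HasAntidiagonal.mem_antidiagonal.mp hp
      have r1 := lpT_rec (2 * α - 1) p.1
      have r2 := lpG_rec (1 - α) (μ + 1 - α) (μ + 1) p.2
      push_cast
      linear_combination q p.1 * r2 + ((n + 1 + p.2 + μ) * g p.2) * r1
        + (n + 1 + p.2 + μ) * q p.1 * g p.2 * hp
  refine congrFun (Continuous.ext_on lp_dense ?_ ?_ hgen) μ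
  · refine continuous_finsetSum _ fun p _ => continuous_const.mul ?_
    exact lpG_continuous _ _ _ (by fun_prop) (by fun_prop) (by fun_prop) _
  · exact lpG_continuous _ _ _ (by fun_prop) (by fun_prop) (by fun_prop) _

lemma lp_grow (f q : ℕ → ℂ) (hf : ∀ᶠ n in Filter.atTop, f (n + 1) = q n * f n)
    (hq : Filter.Tendsto q Filter.atTop (nhds 1)) {r : ℝ} (h0 : 0 < r) (h1 : r < 1) :
    Summable fun n => ‖f n‖ * r ^ n := by
  have hq' : Filter.Tendsto (fun n => ‖q n‖ * r) Filter.atTop (nhds (‖(1 : ℂ)‖ * r)) :=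
    hq.norm.mul_const r
  rw [norm_one, one_mul] at hq'
  have h2 : r < (1 + r) / 2 := by linarith
  have h3 : (1 + r) / 2 < 1 := by linarith
  refine summable_of_ratio_norm_eventually_le h3 ?_
  filter_upwards [hf, hq'.eventually (gt_mem_nhds h2)] with n hn hn2
  rw [hn]
  simp only [norm_mul, norm_norm, norm_pow, Real.norm_of_nonneg h0.le, pow_succ]
  have : 0 ≤ ‖f n‖ * r ^ n := by positivity
  nlinarith

lemma lp_ratio (a c : ℂ) :
    Filter.Tendsto (fun n : ℕ => (a + n) / (c + n)) Filter.atTop (nhds 1) ∧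
      ∀ᶠ n : ℕ in Filter.atTop, c + n ≠ 0 := by
  have h := tendsto_natCast_div_add_atTop (𝕜 := ℂ) c
  have h' := tendsto_natCast_div_add_atTop (𝕜 := ℂ) a
  have e : ∀ᶠ n : ℕ in Filter.atTop, c + n ≠ 0 := by
    filter_upwards [h.eventually_ne one_ne_zero] with n hn hc
    apply hn
    rw [add_comm, hc, div_zero]
  have e' : ∀ᶠ n : ℕ in Filter.atTop, a + n ≠ 0 := by
    filter_upwards [h'.eventually_ne one_ne_zero] with n hn hc
    apply hn
    rw [add_comm, hc, div_zero]
  refine ⟨?_, e⟩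
  have := h.div h' one_ne_zero
  rw [div_one] at this
  refine this.congr' ?_
  filter_upwards [e, e', Filter.eventually_gt_atTop 0] with n h1 h2 h3
  have h3 : (n : ℂ) ≠ 0 := by exact_mod_cast h3.ne'
  rw [add_comm] at h1 h2
  simp only [Pi.div_apply]
  rw [add_comm a, add_comm c]
  field_simp

lemma lpT_summable (a : ℂ) {r : ℝ} (h0 : 0 < r) (h1 : r < 1) :
    Summable fun n => ‖lpT a n‖ * r ^ n := by
  refine lp_grow _ (fun n : ℕ => (a + n) / (1 + n)) ?_ (lp_ratio a 1).1 h0 h1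
  filter_upwards [(lp_ratio a 1).2] with n hn
  have := lpT_rec a n
  rw [div_mul_eq_mul_div, eq_div_iff hn]
  linear_combination this

lemma lpG_summable (a b c : ℂ) {r : ℝ} (h0 : 0 < r) (h1 : r < 1) :
    Summable fun n => ‖lpG a b c n‖ * r ^ n := by
  refine lp_grow _ (fun n : ℕ => (a + n) / (1 + n) * ((b + n) / (c + n))) ?_
    (by simpa using (lp_ratio a 1).1.mul (lp_ratio b c).1) h0 h1
  filter_upwards [(lp_ratio a 1).2, (lp_ratio b c).2] with n hn hn2
  have := lpG_rec a b c n
  rw [div_mul_div_comm, div_mul_eq_mul_div, eq_div_iff (mul_ne_zero hn hn2)]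
  linear_combination this

lemma lpL_bound (a c : ℂ) {r : ℝ} (h1 : 1 < r) : ∃ M : ℝ, 0 ≤ M ∧ ∀ n, ‖lpL a c n‖ ≤ M * r ^ n := by
  have h0 : 0 < r := by linarith
  have hs : Summable fun n => ‖lpL a c n‖ * r⁻¹ ^ n := by
    refine lp_grow _ (fun n : ℕ => (a + n) / (c + n)) ?_ (lp_ratio a c).1 (inv_pos.mpr h0)
      (inv_lt_one_of_one_lt₀ h1)
    filter_upwards [(lp_ratio a c).2] with n hn
    have := lpL_rec a c n
    rw [div_mul_eq_mul_div, eq_div_iff hn]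
    linear_combination this
  refine ⟨∑' n, ‖lpL a c n‖ * r⁻¹ ^ n, tsum_nonneg fun n => by positivity, fun n => ?_⟩
  have := hs.le_tsum n (fun j _ => by positivity)
  rw [inv_pow, ← div_eq_mul_inv, div_le_iff₀ (by positivity)] at this
  exact this

lemma lp_pair_summable {ι : Type*} (ρ : ι → ℂ) (d : ι → ℕ) (f : ℕ → ℂ) {r M : ℝ}
    (hρ : Summable fun k => ‖ρ k‖ * r ^ d k) (hf : ∀ n, ‖f n‖ ≤ M * r ^ n) :
    Summable fun k => ρ k * f (d k) := by
  refine Summable.of_norm_bounded (hρ.mul_left M) fun k => ?_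
  rw [norm_mul]
  calc ‖ρ k‖ * ‖f (d k)‖ ≤ ‖ρ k‖ * (M * r ^ d k) := by gcongr; exact hf _
    _ = _ := by ring

lemma lpRG_mul_Gamma (a : ℂ) (ha : 0 < a.re) (k : ℕ) :
    lpRG a * Complex.Gamma (a + k) = lpPoch a k := by
  induction k with
  | zero =>
    simp only [Nat.cast_zero, add_zero, lpPoch_zero, lpRG]
    exact inv_mul_cancel₀ (Complex.Gamma_ne_zero_of_re_pos ha)
  | succ k ih =>
    have : a + k ≠ 0 := by
      intro h
      have := congrArg Complex.re h
      simp at this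
      have : (0:ℝ) ≤ k := Nat.cast_nonneg k
      linarith
    rw [lpPoch_succ, ← ih]
    push_cast
    rw [← add_assoc, Complex.Gamma_add_one _ this]
    ring

lemma lp_beta_int (a b : ℂ) (ha : 0 < a.re) (hb : 0 < b.re) :
    IntegrableOn (fun u : ℝ => (u : ℂ) ^ (a - 1) * (1 - (u : ℂ)) ^ (b - 1)) (Ioo 0 1) := by
  have := Complex.betaIntegral_convergent ha hb
  rw [intervalIntegrable_iff_integrableOn_Ioo_of_le zero_le_one] at this
  exact this

lemma lp_base (a b : ℂ) (ha : 0 < a.re) (hb : 0 < b.re) (ρ : ℕ → ℂ) (hρ : Summable fun k => ‖ρ k‖) :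
    lpRG a * lpRG b * ∫ u in Ioo (0 : ℝ) 1, (u : ℂ) ^ (a - 1) * (1 - (u : ℂ)) ^ (b - 1) *
      ∑' k, ρ k * (u : ℂ) ^ k = ∑' k, ρ k * lpL a (a + b) k := by
  let F : ℕ → ℝ → ℂ := fun k u => ρ k * ((u : ℂ) ^ ((a + k) - 1) * (1 - (u : ℂ)) ^ (b - 1))
  have hak : ∀ k : ℕ, 0 < (a + k).re := fun k => by simp; positivity
  have hFint : ∀ k, Integrable (F k) (volume.restrict (Ioo 0 1)) := fun k =>
    (lp_beta_int (a + k) b (hak k) hb).const_mul (ρ k)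
  have hsplit : ∀ k : ℕ, ∀ u ∈ Ioo (0 : ℝ) 1, F k u =
      ((u : ℂ) ^ (a - 1) * (1 - (u : ℂ)) ^ (b - 1)) * (ρ k * (u : ℂ) ^ k) := by
    intro k u hu
    simp only [F]
    rw [show a + k - 1 = (a - 1) + k by ring,
      Complex.cpow_add _ _ (by exact_mod_cast hu.1.ne'), Complex.cpow_natCast]
    ring
  have hFsum : Summable fun k => ∫ u in Ioo (0 : ℝ) 1, ‖F k u‖ := by
    refine Summable.of_nonneg_of_le (fun k => integral_nonneg fun u => norm_nonneg _) (fun k => ?_)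
      (hρ.mul_right (∫ u in Ioo (0 : ℝ) 1, ‖(u : ℂ) ^ (a - 1) * (1 - (u : ℂ)) ^ (b - 1)‖))
    rw [← integral_const_mul]
    refine setIntegral_mono_on (hFint k).norm ((lp_beta_int a b ha hb).norm.const_mul _)
      measurableSet_Ioo fun u hu => ?_
    rw [hsplit k u hu, norm_mul, mul_comm]
    gcongr
    rw [norm_mul, norm_pow, Complex.norm_of_nonneg hu.1.le]
    exact mul_le_of_le_one_right (norm_nonneg _) (pow_le_one₀ hu.1.le hu.2.le)
  have hs := hasSum_integral_of_summable_integral_norm hFint hFsum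
  have e1 : ∫ u in Ioo (0 : ℝ) 1, (u : ℂ) ^ (a - 1) * (1 - (u : ℂ)) ^ (b - 1) *
      ∑' k, ρ k * (u : ℂ) ^ k = ∫ u in Ioo (0 : ℝ) 1, ∑' k, F k u := by
    refine setIntegral_congr_fun measurableSet_Ioo fun u hu => ?_
    rw [← tsum_mul_left]
    exact tsum_congr fun k => (hsplit k u hu).symm
  rw [e1, ← hs.tsum_eq, ← tsum_mul_left]
  refine tsum_congr fun k => ?_
  have e2 : ∫ u in Ioo (0 : ℝ) 1, F k u = ρ k * Complex.betaIntegral (a + k) b := by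
    simp only [F]
    rw [integral_const_mul, Complex.betaIntegral, intervalIntegral.integral_of_le zero_le_one,
      integral_Ioc_eq_integral_Ioo]
  rw [e2]
  have e3 := Complex.Gamma_mul_Gamma_eq_betaIntegral (hak k) hb
  have g1 : Complex.Gamma (a + k + b) ≠ 0 :=
    Complex.Gamma_ne_zero_of_re_pos (by have := hak k; simp at this ⊢; linarith)
  have g2 : Complex.Gamma b ≠ 0 := Complex.Gamma_ne_zero_of_re_pos hb
  have e4 := lpRG_mul_Gamma a ha k
  have e5 : Complex.betaIntegral (a + k) b =
      Complex.Gamma (a + k) * Complex.Gamma b * (Complex.Gamma (a + k + b))⁻¹ := by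
    rw [e3]; field_simp
  rw [e5, lpL, ← e4, show a + b + k = a + k + b by ring, lpRG, lpRG, lpRG]
  field_simp

lemma lp_nonint (a : ℂ) (g : ℝ → ℂ) (L : ℂ) (hL : L ≠ 0)
    (hg : Filter.Tendsto g (nhdsWithin 0 (Ioi 0)) (nhds L))
    (hint : IntegrableOn (fun u : ℝ => (u : ℂ) ^ (a - 1) * g u) (Ioo 0 1)) : 0 < a.re := by
  have h1 : ∀ᶠ u in nhdsWithin (0:ℝ) (Ioi 0), ‖L‖ / 2 < ‖g u‖ :=
    hg.norm.eventually (lt_mem_nhds (half_lt_self (norm_pos_iff.mpr hL)))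
  rw [eventually_nhdsWithin_iff, Metric.eventually_nhds_iff] at h1
  obtain ⟨ε, hε, h1⟩ := h1
  set δ := min ε 1 with hδ
  have hδ0 : 0 < δ := lt_min hε one_pos
  have h2 : IntegrableOn (fun u : ℝ => (u : ℂ) ^ (a - 1)) (Ioo 0 δ) := by
    have h3 : IntegrableOn (fun u : ℝ => (u : ℂ) ^ (a - 1) * g u) (Ioo 0 δ) :=
      hint.mono_set (Ioo_subset_Ioo le_rfl (min_le_right _ _))
    refine Integrable.mono' (h3.norm.const_mul (2 / ‖L‖)) ?_ ?_
    · refine ContinuousOn.aestronglyMeasurable ?_ measurableSet_Ioo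
      intro u hu
      refine ContinuousAt.continuousWithinAt ?_
      refine ContinuousAt.cpow Complex.continuous_ofReal.continuousAt continuousAt_const ?_
      exact Complex.ofReal_mem_slitPlane.mpr hu.1
    · refine (ae_restrict_iff' measurableSet_Ioo).mpr (Filter.Eventually.of_forall fun u hu => ?_)
      have := h1 (y := u) (by
        rw [Real.dist_eq, sub_zero, abs_of_pos hu.1]
        exact lt_of_lt_of_le hu.2 (min_le_left _ _)) hu.1
      rw [norm_mul]
      have hLp := norm_pos_iff.mpr hL
      have hx : 1 ≤ 2 / ‖L‖ * ‖g u‖ := by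
        rw [div_mul_eq_mul_div, le_div_iff₀ hLp]; linarith
      nlinarith [norm_nonneg ((u : ℂ) ^ (a - 1))]
  rw [intervalIntegral.integrableOn_Ioo_cpow_iff hδ0] at h2
  simp at h2
  exact h2

lemma lp_cont (ρ : ℕ → ℂ) (hρ : Summable fun k => ‖ρ k‖) :
    ContinuousOn (fun u : ℝ => ∑' k, ρ k * (u : ℂ) ^ k) (Icc 0 1) := by
  refine continuousOn_tsum (fun k => by fun_prop) hρ fun k u hu => ?_
  rw [norm_mul, norm_pow, Complex.norm_of_nonneg hu.1]
  exact mul_le_of_le_one_right (norm_nonneg _) (pow_le_one₀ hu.1 hu.2)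

lemma lp_zero_end (a b : ℂ) (ha : a.re ≤ 0) (ρ : ℕ → ℂ) (hρ : Summable fun k => ‖ρ k‖)
    (hint : IntegrableOn (fun u : ℝ => (u : ℂ) ^ (a - 1) * (1 - (u : ℂ)) ^ (b - 1) *
      ∑' k, ρ k * (u : ℂ) ^ k) (Ioo 0 1)) : ρ 0 = 0 := by
  by_contra h
  have hc := lp_cont ρ hρ 0 (by simp)
  have hc' : Filter.Tendsto (fun u : ℝ => ∑' k, ρ k * (u : ℂ) ^ k) (nhdsWithin 0 (Ioi 0))
      (nhds (ρ 0)) := by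
    have h0 : ∑' k, ρ k * ((0:ℝ) : ℂ) ^ k = ρ 0 := by
      rw [tsum_eq_single 0]
      · simp
      · intro k hk; simp [hk]
    have := hc.tendsto
    simp only [h0] at this
    refine this.mono_left (nhdsWithin_le_of_mem ?_)
    exact Icc_mem_nhdsGT_of_mem (by simp)
  have hb : Filter.Tendsto (fun u : ℝ => (1 - (u : ℂ)) ^ (b - 1)) (nhdsWithin 0 (Ioi 0))
      (nhds 1) := by
    have : ContinuousAt (fun u : ℝ => (1 - (u : ℂ)) ^ (b - 1)) 0 := by
      refine ContinuousAt.cpow (by fun_prop) continuousAt_const (by simp)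
    have := this.tendsto
    simp only [Complex.ofReal_zero, sub_zero, Complex.one_cpow] at this
    exact this.mono_left nhdsWithin_le_nhds
  have := lp_nonint a _ (1 * ρ 0) (by simpa using h) (hb.mul hc') (by simpa only [mul_assoc] using hint)
  linarith

lemma lp_one_end (a b : ℂ) (hb : b.re ≤ 0) (ρ : ℕ → ℂ) (hρ : Summable fun k => ‖ρ k‖)
    (hint : IntegrableOn (fun u : ℝ => (u : ℂ) ^ (a - 1) * (1 - (u : ℂ)) ^ (b - 1) *
      ∑' k, ρ k * (u : ℂ) ^ k) (Ioo 0 1)) : ∑' k, ρ k = 0 := by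
  by_contra h
  rw [← intervalIntegrable_iff_integrableOn_Ioo_of_le zero_le_one] at hint
  have hint2 := (hint.comp_sub_left 1).symm
  simp only [sub_zero, sub_self] at hint2
  rw [intervalIntegrable_iff_integrableOn_Ioo_of_le zero_le_one] at hint2
  have hc := lp_cont ρ hρ 1 (by simp)
  have hlim : Filter.Tendsto (fun u : ℝ => 1 - u) (nhdsWithin 0 (Ioi 0)) (nhdsWithin 1 (Icc 0 1)) := by
    refine tendsto_nhdsWithin_iff.mpr ⟨?_, ?_⟩
    · have : ContinuousAt (fun u : ℝ => 1 - u) 0 := by fun_prop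
      have := this.tendsto
      simp only [sub_zero] at this
      exact this.mono_left nhdsWithin_le_nhds
    · filter_upwards [Icc_mem_nhdsGT_of_mem (show (0:ℝ) ∈ Ico (0:ℝ) 1 by simp)] with u hu
      constructor <;> linarith [hu.1, hu.2]
  have hc' := hc.tendsto.comp hlim
  have ha : Filter.Tendsto (fun u : ℝ => ((1 - u : ℝ) : ℂ) ^ (a - 1)) (nhdsWithin 0 (Ioi 0))
      (nhds 1) := by
    have : ContinuousAt (fun u : ℝ => ((1 - u : ℝ) : ℂ) ^ (a - 1)) 0 := by
      refine ContinuousAt.cpow (by fun_prop) continuousAt_const (by simp)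
    have := this.tendsto
    simp only [sub_zero, Complex.ofReal_one, Complex.one_cpow] at this
    exact this.mono_left nhdsWithin_le_nhds
  have := lp_nonint b _ (1 * ∑' k, ρ k * ((1 : ℝ) : ℂ) ^ k) (by simpa using h) (ha.mul hc') (by
    refine hint2.congr_fun (fun u hu => ?_) measurableSet_Ioo
    simp only [Function.comp]
    rw [show (1 - ((1 - u : ℝ) : ℂ)) = u by push_cast; ring]
    ring)
  linarith

lemma lp_norm_summable {ρ : ℕ → ℂ} {r : ℝ} (hr : 1 < r) (hρ : Summable fun k => ‖ρ k‖ * r ^ k) :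
    Summable fun k => ‖ρ k‖ := by
  refine Summable.of_nonneg_of_le (fun _ => norm_nonneg _) (fun k => ?_) hρ
  exact le_mul_of_one_le_right (norm_nonneg _) (one_le_pow₀ hr.le)

lemma lp_pairing_left (n : ℕ) : ∀ (a b : ℂ), -(n : ℝ) < a.re → 0 < b.re → ∀ (ρ : ℕ → ℂ) (r : ℝ),
    1 < r → (Summable fun k => ‖ρ k‖ * r ^ k) →
    IntegrableOn (fun u : ℝ => (u : ℂ) ^ (a - 1) * (1 - (u : ℂ)) ^ (b - 1) *
      ∑' k, ρ k * (u : ℂ) ^ k) (Ioo 0 1) →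
    lpRG a * lpRG b * ∫ u in Ioo (0 : ℝ) 1, (u : ℂ) ^ (a - 1) * (1 - (u : ℂ)) ^ (b - 1) *
      ∑' k, ρ k * (u : ℂ) ^ k = ∑' k, ρ k * lpL a (a + b) k := by
  induction n with
  | zero =>
    intro a b ha hb ρ r hr hρ hint
    exact lp_base a b (by simpa using ha) hb ρ (lp_norm_summable hr hρ)
  | succ n ih =>
    intro a b ha hb ρ r hr hρ hint
    have hρ' := lp_norm_summable hr hρ
    by_cases hap : 0 < a.re
    · exact lp_base a b hap hb ρ hρ'
    have h0 := lp_zero_end a b (not_lt.mp hap) ρ hρ' hint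
    have hσ : Summable fun k => ‖ρ (k + 1)‖ * r ^ k := by
      have := ((summable_nat_add_iff 1).mpr hρ).mul_right r⁻¹
      refine this.congr fun k => ?_
      rw [pow_succ]; field_simp
    have heq : EqOn (fun u : ℝ => (u : ℂ) ^ (a - 1) * (1 - (u : ℂ)) ^ (b - 1) *
      ∑' k, ρ k * (u : ℂ) ^ k) (fun u : ℝ => (u : ℂ) ^ (a + 1 - 1) * (1 - (u : ℂ)) ^ (b - 1) *
      ∑' k, ρ (k + 1) * (u : ℂ) ^ k) (Ioo 0 1) := by
      intro u hu
      have hs : Summable fun k => ρ k * (u : ℂ) ^ k := by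
        refine Summable.of_norm_bounded hρ' fun k => ?_
        rw [norm_mul, norm_pow, Complex.norm_of_nonneg hu.1.le]
        exact mul_le_of_le_one_right (norm_nonneg _) (pow_le_one₀ hu.1.le hu.2.le)
      simp only
      rw [hs.tsum_eq_zero_add, h0, zero_mul, zero_add,
        show a + 1 - 1 = (a - 1) + 1 by ring, Complex.cpow_add _ _ (by exact_mod_cast hu.1.ne'),
        Complex.cpow_one]
      simp only [pow_succ, ← mul_assoc]
      rw [tsum_mul_right]; ring
    rw [setIntegral_congr_fun measurableSet_Ioo heq]
    have := ih (a + 1) b (by simp at ha ⊢; linarith) hb (fun k => ρ (k + 1)) r hr hσ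
      (hint.congr_fun heq measurableSet_Ioo)
    rw [lpRG_rec a, mul_assoc a, mul_assoc a, this, ← tsum_mul_left]
    obtain ⟨M, _, hM⟩ := lpL_bound a (a + b) hr
    have hsum : Summable fun k => ρ k * lpL a (a + b) k := lp_pair_summable ρ id _ hρ hM
    rw [hsum.tsum_eq_zero_add]
    simp only [h0, zero_mul, zero_add]
    refine tsum_congr fun k => ?_
    simp only [lpL]
    rw [lpPoch_succ_left, show a + 1 + b + k = a + b + ((k + 1 : ℕ) : ℂ) by push_cast; ring]
    ring

lemma lp_abel (ρ σ f : ℕ → ℂ) (h0 : σ 0 = ρ 0) (hs : ∀ k, ρ (k + 1) = σ (k + 1) - σ k)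
    (h1 : Summable fun k => σ k * f k) (h2 : Summable fun k => σ k * f (k + 1)) :
    ∑' k, ρ k * f k = ∑' k, σ k * (f k - f (k + 1)) := by
  have e : (fun k => ρ (k + 1) * f (k + 1)) =
      fun k => σ (k + 1) * f (k + 1) - σ k * f (k + 1) := by
    funext k; rw [hs]; ring
  have h3 : Summable fun k => ρ (k + 1) * f (k + 1) := by
    rw [e]
    exact ((summable_nat_add_iff (f := fun k => σ k * f k) 1).mpr h1).sub h2
  have h4 : Summable fun k => ρ k * f k := (summable_nat_add_iff 1).mp h3
  rw [h4.tsum_eq_zero_add, e, ((summable_nat_add_iff (f := fun k => σ k * f k) 1).mpr h1).tsum_sub h2]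
  simp only [mul_sub]
  rw [h1.tsum_sub h2, h1.tsum_eq_zero_add, h0]
  ring

lemma lp_pairing_aux (n : ℕ) : ∀ (a b : ℂ), -(n : ℝ) < b.re → ∀ (ρ : ℕ → ℂ) (r : ℝ),
    1 < r → (Summable fun k => ‖ρ k‖ * r ^ k) →
    IntegrableOn (fun u : ℝ => (u : ℂ) ^ (a - 1) * (1 - (u : ℂ)) ^ (b - 1) *
      ∑' k, ρ k * (u : ℂ) ^ k) (Ioo 0 1) →
    lpRG a * lpRG b * ∫ u in Ioo (0 : ℝ) 1, (u : ℂ) ^ (a - 1) * (1 - (u : ℂ)) ^ (b - 1) *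
      ∑' k, ρ k * (u : ℂ) ^ k = ∑' k, ρ k * lpL a (a + b) k := by
  have base : ∀ (a b : ℂ), 0 < b.re → ∀ (ρ : ℕ → ℂ) (r : ℝ),
      1 < r → (Summable fun k => ‖ρ k‖ * r ^ k) →
      IntegrableOn (fun u : ℝ => (u : ℂ) ^ (a - 1) * (1 - (u : ℂ)) ^ (b - 1) *
        ∑' k, ρ k * (u : ℂ) ^ k) (Ioo 0 1) →
      lpRG a * lpRG b * ∫ u in Ioo (0 : ℝ) 1, (u : ℂ) ^ (a - 1) * (1 - (u : ℂ)) ^ (b - 1) *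
        ∑' k, ρ k * (u : ℂ) ^ k = ∑' k, ρ k * lpL a (a + b) k := by
    intro a b hb
    obtain ⟨m, hm⟩ := exists_nat_gt (-a.re)
    exact lp_pairing_left m a b (by linarith) hb
  induction n with
  | zero =>
    intro a b hb
    exact base a b (by simpa using hb)
  | succ n ih =>
    intro a b hb ρ r hr hρ hint
    by_cases hbp : 0 < b.re
    · exact base a b hbp ρ r hr hρ hint
    have hρ' := lp_norm_summable hr hρ
    have h0 := lp_one_end a b (not_lt.mp hbp) ρ hρ' hint
    set σ : ℕ → ℂ := fun k => ∑ j ∈ Finset.range (k + 1), ρ j with hσ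
    have hr0 : 0 < r := by linarith
    set M := ∑' k, ‖ρ k‖ * r ^ k with hM
    have hσb : ∀ k, ‖σ k‖ ≤ M * r⁻¹ ^ (k + 1) := by
      intro k
      have h1 := hρ'.of_norm.sum_add_tsum_nat_add (k + 1)
      rw [h0] at h1
      have h2 : σ k = -∑' i, ρ (i + (k + 1)) := eq_neg_of_add_eq_zero_left h1
      rw [h2, norm_neg]
      have h3 : Summable fun i => ‖ρ (i + (k + 1))‖ * r ^ (i + (k + 1)) :=
        (summable_nat_add_iff (f := fun k => ‖ρ k‖ * r ^ k) (k + 1)).mpr hρ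
      have h4 : ∑' i, ‖ρ (i + (k + 1))‖ * r ^ (i + (k + 1)) ≤ M := by
        have := hρ.sum_add_tsum_nat_add (k + 1)
        have h5 : 0 ≤ ∑ i ∈ Finset.range (k + 1), ‖ρ i‖ * r ^ i :=
          Finset.sum_nonneg fun i _ => by positivity
        linarith
      refine (tsum_of_norm_bounded ((h3.mul_right (r⁻¹ ^ (k + 1))).hasSum) fun i => ?_).trans ?_
      · rw [pow_add, mul_assoc, mul_assoc, ← mul_pow, mul_inv_cancel₀ hr0.ne', one_pow, mul_one]
        exact le_mul_of_one_le_right (norm_nonneg _) (one_le_pow₀ hr.le)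
      · rw [tsum_mul_right]
        gcongr
    set r' := (1 + r) / 2 with hr'
    have hr1 : 1 < r' := by rw [hr']; linarith
    have hrr : r' < r := by rw [hr']; linarith
    have hσs : Summable fun k => ‖σ k‖ * r' ^ k := by
      have hg : Summable fun k : ℕ => (r⁻¹ * r') ^ k := by
        refine summable_geometric_of_lt_one (by positivity) ?_
        rw [inv_mul_lt_iff₀ hr0]; linarith
      refine Summable.of_nonneg_of_le (fun k => by positivity) (fun k => ?_) (hg.mul_left (M * r⁻¹))
      calc ‖σ k‖ * r' ^ k ≤ M * r⁻¹ ^ (k + 1) * r' ^ k := by gcongr; exact hσb k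
        _ = _ := by rw [mul_pow]; ring
    have hσ' := lp_norm_summable hr1 hσs
    have hs0 : σ 0 = ρ 0 := by simp [hσ]
    have hss : ∀ k, ρ (k + 1) = σ (k + 1) - σ k := by
      intro k
      simp only [hσ]
      rw [Finset.sum_range_succ _ (k + 1)]; ring
    have heq : EqOn (fun u : ℝ => (u : ℂ) ^ (a - 1) * (1 - (u : ℂ)) ^ (b - 1) *
      ∑' k, ρ k * (u : ℂ) ^ k) (fun u : ℝ => (u : ℂ) ^ (a - 1) * (1 - (u : ℂ)) ^ (b + 1 - 1) *
      ∑' k, σ k * (u : ℂ) ^ k) (Ioo 0 1) := by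
      intro u hu
      have hs : Summable fun k => σ k * (u : ℂ) ^ k := by
        refine Summable.of_norm_bounded hσ' fun k => ?_
        rw [norm_mul, norm_pow, Complex.norm_of_nonneg hu.1.le]
        exact mul_le_of_le_one_right (norm_nonneg _) (pow_le_one₀ hu.1.le hu.2.le)
      simp only
      rw [lp_abel ρ σ (fun k => (u : ℂ) ^ k) hs0 hss hs
        ((hs.mul_right (u : ℂ)).congr fun k => by rw [pow_succ]; ring)]
      have : (fun k => σ k * ((u : ℂ) ^ k - (u : ℂ) ^ (k + 1))) =
          fun k => (1 - (u : ℂ)) * (σ k * (u : ℂ) ^ k) := by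
        funext k; rw [pow_succ]; ring
      rw [this, tsum_mul_left, show b + 1 - 1 = (b - 1) + 1 by ring, Complex.cpow_add _ _ (by
        have := hu.2.ne
        intro h
        apply this
        have : (u : ℂ) = 1 := by linear_combination -h
        exact_mod_cast this), Complex.cpow_one]
      ring
    rw [setIntegral_congr_fun measurableSet_Ioo heq]
    have := ih a (b + 1) (by simp at hb ⊢; linarith) σ r' hr1 hσs
      (hint.congr_fun heq measurableSet_Ioo)
    obtain ⟨M', _, hM'⟩ := lpL_bound a (a + b) hr1
    rw [lpRG_rec b, show ∀ x : ℂ, lpRG a * (b * lpRG (b + 1)) * x = b * (lpRG a * lpRG (b + 1) * x)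
      from fun x => by ring, this, lp_abel ρ σ (lpL a (a + b)) hs0 hss
      (lp_pair_summable σ id _ hσs hM')
      (lp_pair_summable (M := M' * r') σ id (fun k => lpL a (a + b) (k + 1)) hσs
        fun n => (hM' (n + 1)).trans_eq (by rw [pow_succ]; ring)), ← tsum_mul_left]
    refine tsum_congr fun k => ?_
    simp only [lpL]
    rw [lpPoch_succ, lpRG_rec (a + b + k), show a + (b + 1) + k = a + b + k + 1 by ring,
      show a + b + ((k + 1 : ℕ) : ℂ) = a + b + k + 1 by push_cast; ring]
    ring

lemma lp_pairing (a b : ℂ) (ρ : ℕ → ℂ) (r : ℝ) (hr : 1 < r)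
    (hρ : Summable fun k => ‖ρ k‖ * r ^ k)
    (hint : IntegrableOn (fun u : ℝ => (u : ℂ) ^ (a - 1) * (1 - (u : ℂ)) ^ (b - 1) *
      ∑' k, ρ k * (u : ℂ) ^ k) (Ioo 0 1)) :
    lpRG a * lpRG b * ∫ u in Ioo (0 : ℝ) 1, (u : ℂ) ^ (a - 1) * (1 - (u : ℂ)) ^ (b - 1) *
      ∑' k, ρ k * (u : ℂ) ^ k = ∑' k, ρ k * lpL a (a + b) k := by
  obtain ⟨m, hm⟩ := exists_nat_gt (-b.re)
  exact lp_pairing_aux m a b (by linarith) ρ r hr hρ hint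

lemma lp_choose (a : ℂ) (n : ℕ) : Ring.choose (a + n - 1) n = lpT a n := by
  rw [← Ring.multichoose_eq]
  have h := Ring.factorial_nsmul_multichoose_eq_ascPochhammer a n
  rw [Polynomial.ascPochhammer_smeval_eq_eval, nsmul_eq_mul] at h
  have h2 : (n.factorial : ℂ) ≠ 0 := by exact_mod_cast n.factorial_ne_zero
  unfold lpT lpPoch
  rw [← h]
  field_simp

lemma lp_binom (a x : ℂ) (hx : ‖x‖ < 1) : HasSum (fun n => lpT a n * x ^ n) ((1 - x) ^ (-a)) := by
  have h := (Complex.one_div_one_sub_cpow_hasFPowerSeriesOnBall_zero a).hasSum (y := x) (by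
    simp only [Metric.mem_eball, edist_zero_right, enorm_eq_nnnorm]
    exact_mod_cast hx)
  simp only [zero_add, FormalMultilinearSeries.ofScalars_apply_eq, lp_choose, smul_eq_mul] at h
  rw [Complex.cpow_neg, ← one_div]
  exact h

lemma lpG_hasSum (a b c w : ℂ) (hw : ‖w‖ < 1) :
    HasSum (fun n => lpG a b c n * w ^ n) (hyp2F1reg a b c w) := by
  have h : Summable fun n => lpG a b c n * w ^ n := by
    obtain ⟨r, h1, h2⟩ := exists_between hw
    have := lpG_summable a b c (lt_of_le_of_lt (norm_nonneg w) h1) h2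
    refine Summable.of_norm_bounded this fun n => ?_
    rw [norm_mul, norm_pow]
    gcongr
  convert h.hasSum using 1
  unfold hyp2F1reg lpG lpRG lpPoch
  congr 1; ext n; congr 1
  rw [div_eq_mul_inv, mul_inv, div_eq_mul_inv]; ring

lemma lpG_norm_summable (a b c w : ℂ) (hw : ‖w‖ < 1) : Summable (fun n => ‖lpG a b c n * w ^ n‖) :=
  (lpG_hasSum a b c w hw).summable.norm

lemma lpT_norm_summable (a w : ℂ) (hw : ‖w‖ < 1) : Summable (fun n => ‖lpT a n * w ^ n‖) :=
  (lp_binom a w hw).summable.norm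

lemma lp_euler_fun (α μ w : ℂ) (hw : ‖w‖ < 1) :
    hyp2F1reg α (α + μ) (μ + 1) w =
      (1 - w) ^ (1 - 2 * α) * hyp2F1reg (1 - α) (μ + 1 - α) (μ + 1) w := by
  rw [← (lpG_hasSum α (α + μ) (μ + 1) w hw).tsum_eq,
    ← (lpG_hasSum (1 - α) (μ + 1 - α) (μ + 1) w hw).tsum_eq,
    show (1 - 2 * α) = -(2 * α - 1) by ring, ← (lp_binom (2 * α - 1) w hw).tsum_eq,
    tsum_mul_tsum_eq_tsum_sum_antidiagonal_of_summable_norm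
      (lpT_norm_summable _ w hw) (lpG_norm_summable _ _ _ w hw)]
  congr 1; ext n
  rw [← lp_euler, Finset.sum_mul]
  refine Finset.sum_congr rfl fun p hp => ?_
  rw [Finset.HasAntidiagonal.mem_antidiagonal] at hp
  rw [← hp, pow_add]; ring

/-- Coefficients of `(1-w) G(w)`. -/
noncomputable def lpD (α μ : ℂ) : ℕ → ℂ
  | 0 => lpG α (α + μ) (μ + 1) 0
  | n + 1 => lpG α (α + μ) (μ + 1) (n + 1) - lpG α (α + μ) (μ + 1) n

lemma lpD_hasSum (α μ w : ℂ) (hw : ‖w‖ < 1) :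
    HasSum (fun n => lpD α μ n * w ^ n) ((1 - w) * hyp2F1reg α (α + μ) (μ + 1) w) := by
  have h := lpG_hasSum α (α + μ) (μ + 1) w hw
  have h2 : HasSum (fun n => match n with
      | 0 => 0
      | n + 1 => lpG α (α + μ) (μ + 1) n * w ^ (n + 1)) (w * hyp2F1reg α (α + μ) (μ + 1) w) := by
    rw [← hasSum_nat_add_iff' 1]
    simp only [Finset.range_one, Finset.sum_singleton, sub_zero]
    have e : (fun n => lpG α (α + μ) (μ + 1) n * w ^ (n + 1)) =
        fun n => w * (lpG α (α + μ) (μ + 1) n * w ^ n) := by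
      funext n; ring
    rw [e]
    exact h.mul_left w
  have h3 := h.sub h2
  rw [show (1 - w) * hyp2F1reg α (α + μ) (μ + 1) w = hyp2F1reg α (α + μ) (μ + 1) w -
    w * hyp2F1reg α (α + μ) (μ + 1) w by ring]
  refine h3.congr_fun ?_
  intro n
  cases n with
  | zero => simp [lpD]
  | succ n => simp [lpD]; ring

lemma lp_fiber {ι : Type*} (x : ι → ℂ) (d : ι → ℕ) {r : ℝ} (hr : 1 < r)
    (hx : Summable fun i => ‖x i‖ * r ^ d i) :
    ∃ ρ : ℕ → ℂ, (Summable fun k => ‖ρ k‖ * r ^ k) ∧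
      ∀ (f : ℕ → ℂ) (M : ℝ), (∀ n, ‖f n‖ ≤ M * r ^ n) →
        HasSum (fun i => x i * f (d i)) (∑' k, ρ k * f k) := by
  have h0 : 0 < r := by linarith
  have hs := (Equiv.sigmaFiberEquiv d).summable_iff.2 hx
  have hpos : ∀ p, 0 ≤ ((fun i => ‖x i‖ * r ^ d i) ∘ (Equiv.sigmaFiberEquiv d)) p := fun p => by
    simp only [Function.comp]; positivity
  have hs2 := (summable_sigma_of_nonneg hpos).1 hs
  have key : ∀ k, Summable fun i : {i // d i = k} => ‖x i‖ * r ^ k := by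
    intro k
    refine (hs2.1 k).congr fun i => ?_
    simp [Equiv.sigmaFiberEquiv, i.2]
  have key2 : ∀ k, Summable fun i : {i // d i = k} => ‖x i‖ := fun k =>
    (summable_mul_right_iff (by positivity)).1 (key k)
  have hρ : Summable fun k => ‖∑' i : {i // d i = k}, x i‖ * r ^ k := by
    refine Summable.of_nonneg_of_le (fun k => by positivity) (fun k => ?_) hs2.2
    have e : (∑' y, ((fun i => ‖x i‖ * r ^ d i) ∘ (Equiv.sigmaFiberEquiv d)) ⟨k, y⟩)
        = (∑' i : {i // d i = k}, ‖x i‖) * r ^ k := by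
      rw [← tsum_mul_right]
      refine tsum_congr fun i => ?_
      simp [Equiv.sigmaFiberEquiv, i.2]
    rw [e]
    gcongr
    exact norm_tsum_le_tsum_norm (key2 k)
  refine ⟨fun k => ∑' i : {i // d i = k}, x i, hρ, fun f M hf => ?_⟩
  have hsum := lp_pair_summable x d f hx hf
  have h1 := (Equiv.sigmaFiberEquiv d).hasSum_iff.2 hsum.hasSum
  have h2 := h1.sigma (g := fun k => (∑' i : {i // d i = k}, x i) * f k) (fun k => by
    have := ((key2 k).of_norm.hasSum).mul_right (f k)
    refine this.congr_fun ?_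
    intro i
    simp [Equiv.sigmaFiberEquiv, i.2])
  rw [h2.tsum_eq]
  exact hsum.hasSum

lemma lp_two {ι κ : Type} (f : ι → ℂ) (g : κ → ℂ) (s t : ℂ) (hf : HasSum f s) (hg : HasSum g t) :
    HasSum (fun p : ι × κ => f p.1 * g p.2) (s * t) := by
  have h1 : Summable fun i => ‖f i‖ := hf.summable.norm
  have h2 : Summable fun i => ‖g i‖ := hg.summable.norm
  have h3 : Summable (fun p : ι × κ => f p.1 * g p.2) := summable_mul_of_summable_norm h1 h2
  have h4 := tsum_mul_tsum_of_summable_norm h1 h2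
  rw [hf.tsum_eq, hg.tsum_eq] at h4
  rw [h4]
  exact h3.hasSum

lemma lp_four (f₁ f₂ f₃ f₄ : ℕ → ℂ) (s₁ s₂ s₃ s₄ : ℂ) (h₁ : HasSum f₁ s₁) (h₂ : HasSum f₂ s₂)
    (h₃ : HasSum f₃ s₃) (h₄ : HasSum f₄ s₄) :
    HasSum (fun p : (ℕ × ℕ) × (ℕ × ℕ) => f₁ p.1.1 * f₂ p.1.2 * (f₃ p.2.1 * f₄ p.2.2))
      (s₁ * s₂ * (s₃ * s₄)) :=
  lp_two (fun p : ℕ × ℕ => f₁ p.1 * f₂ p.2) (fun p : ℕ × ℕ => f₃ p.1 * f₄ p.2) _ _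
    (lp_two f₁ f₂ _ _ h₁ h₂) (lp_two f₃ f₄ _ _ h₃ h₄)

/-- Terms of the quadruple series. -/
noncomputable def lpX (α μ X Y : ℂ) (p : (ℕ × ℕ) × (ℕ × ℕ)) : ℂ :=
  (lpT (1 - α) p.1.1 * X ^ p.1.1) * (lpT (1 - α) p.1.2 * Y ^ p.1.2) *
    ((lpT (1 - α) p.2.1 * (X * Y) ^ p.2.1) * (lpD α μ p.2.2 * (X * Y) ^ p.2.2))

/-- Degrees of the terms of the quadruple series. -/
def lpdeg (p : (ℕ × ℕ) × (ℕ × ℕ)) : ℕ := p.1.1 + p.1.2 + p.2.1 + 2 * p.2.2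

lemma lpX_scale (α μ X Y u : ℂ) (hX : ‖u * X‖ < 1) (hY : ‖u * Y‖ < 1) (hXY : ‖u * (X * Y)‖ < 1)
    (hw : ‖u ^ 2 * (X * Y)‖ < 1) :
    HasSum (fun p => lpX α μ X Y p * u ^ lpdeg p)
      ((1 - u * X) ^ (α - 1) * (1 - u * Y) ^ (α - 1) * ((1 - u * (X * Y)) ^ (α - 1) *
        ((1 - u ^ 2 * (X * Y)) * hyp2F1reg α (α + μ) (μ + 1) (u ^ 2 * (X * Y))))) := by
  have := lp_four _ _ _ _ _ _ _ _ (lp_binom (1 - α) _ hX) (lp_binom (1 - α) _ hY)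
    (lp_binom (1 - α) _ hXY) (lpD_hasSum α μ _ hw)
  rw [neg_sub] at this
  refine this.congr_fun ?_
  rintro ⟨⟨i, j⟩, m, n⟩
  simp only [lpX, lpdeg, mul_pow, pow_add, pow_mul]
  ring

lemma lpX_summable (α μ X Y : ℂ) (r : ℝ) (hr : 1 < r) (hX : r * ‖X‖ < 1) (hY : r * ‖Y‖ < 1) :
    Summable fun p => ‖lpX α μ X Y p‖ * r ^ lpdeg p := by
  have hX' : ‖X‖ < 1 := by nlinarith [norm_nonneg X]
  have e : ‖(r : ℂ)‖ = r := by simp; linarith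
  have := (lpX_scale α μ X Y r (by rwa [norm_mul, e]) (by rwa [norm_mul, e])
    (by rw [norm_mul, norm_mul, e]; nlinarith [norm_nonneg X, norm_nonneg Y])
    (by
      rw [norm_mul, norm_mul, norm_pow, e]
      have : r ^ 2 * (‖X‖ * ‖Y‖) = (r * ‖X‖) * (r * ‖Y‖) := by ring
      rw [this]
      have h1 : 0 ≤ r * ‖X‖ := by positivity
      have h2 : 0 ≤ r * ‖Y‖ := by positivity
      nlinarith)).summable.norm
  refine this.congr fun p => ?_
  rw [norm_mul, norm_pow, e]

lemma lp_abel_fin (α μ : ℂ) (b : ℕ → ℂ) (N : ℕ) :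
    ∑ n ∈ Finset.range (N + 1), lpD α μ n * b n =
      ∑ n ∈ Finset.range (N + 1), lpG α (α + μ) (μ + 1) n * (b n - b (n + 1)) +
        lpG α (α + μ) (μ + 1) N * b (N + 1) := by
  induction N with
  | zero => simp [lpD]; ring
  | succ N ih => rw [Finset.sum_range_succ, ih, Finset.sum_range_succ _ (N + 1)]; simp [lpD]; ring

lemma lpX_pair (α μ X Y : ℂ) (hX : ‖X‖ < 1) (hY : ‖Y‖ < 1) (s : ℂ)
    (hs : HasSum (fun p => lpX α μ X Y p * lpL (μ + 1 - α) (μ + 1) (lpdeg p)) s) :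
    s = hyp2F1reg (1 - α) (μ + 1 - α) (μ + 1) X * hyp2F1reg (1 - α) (μ + 1 - α) (μ + 1) Y := by
  set E : (ℕ × ℕ) × (ℕ × ℕ) → ℂ := fun q =>
    lpTz (1 - α) ((q.1.1 : ℤ) - q.2.2 - q.2.1) * lpTz (1 - α) ((q.1.2 : ℤ) - q.2.2 - q.2.1) *
      lpTz (1 - α) q.2.1 * lpL (μ + 1 - α) (μ + 1) ((q.1.1 : ℤ) + q.1.2 - q.2.1).toNat *
      lpD α μ q.2.2 * (X ^ q.1.1 * Y ^ q.1.2) with hE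
  let e : (ℕ × ℕ) × (ℕ × ℕ) → (ℕ × ℕ) × (ℕ × ℕ) := fun p =>
    ((p.1.1 + p.2.1 + p.2.2, p.1.2 + p.2.1 + p.2.2), p.2)
  have he : Function.Injective e := by
    rintro ⟨⟨i, j⟩, m, n⟩ ⟨⟨i', j'⟩, m', n'⟩ h
    simp only [e, Prod.mk.injEq] at h ⊢
    omega
  have hz : ∀ q, q ∉ Set.range e → E q = 0 := by
    rintro ⟨⟨k, l⟩, m, n⟩ hq
    by_cases h1 : m + n ≤ k
    · by_cases h2 : m + n ≤ l
      · exfalso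
        apply hq
        refine ⟨((k - m - n, l - m - n), (m, n)), ?_⟩
        simp only [e, Prod.mk.injEq, and_true]
        omega
      · simp only [hE]
        rw [lpTz_neg (1 - α) (i := (l : ℤ) - n - m) (by omega)]; simp
    · simp only [hE]
      rw [lpTz_neg (1 - α) (i := (k : ℤ) - n - m) (by omega)]; simp
  have hEs : HasSum E s := by
    rw [← he.hasSum_iff hz]
    refine hs.congr_fun ?_
    rintro ⟨⟨i, j⟩, m, n⟩
    simp only [hE, e, Function.comp, lpX, lpdeg]
    rw [show ((i + m + n : ℕ) : ℤ) - n - m = (i : ℕ) by push_cast; ring,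
      show ((j + m + n : ℕ) : ℤ) - n - m = (j : ℕ) by push_cast; ring,
      show (((i + m + n : ℕ) : ℤ) + (j + m + n : ℕ) - m).toNat = i + j + m + 2 * n by omega,
      lpTz_nat, lpTz_nat, lpTz_nat]
    simp only [mul_pow, pow_add]
    ring
  have hfib : ∀ b : ℕ × ℕ, HasSum (fun c => E (b, c))
      ((lpG (1 - α) (μ + 1 - α) (μ + 1) b.1 * X ^ b.1) *
        (lpG (1 - α) (μ + 1 - α) (μ + 1) b.2 * Y ^ b.2)) := by
    rintro ⟨k, l⟩
    have h := hasSum_sum_of_ne_finset_zero (L := .unconditional _) (f := fun c => E ((k, l), c))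
      (s := Finset.range (k + 1) ×ˢ Finset.range (k + 1)) (by
        rintro ⟨m, n⟩ hmn
        simp only [hE]
        rw [lpTz_neg (1 - α) (i := (k : ℤ) - n - m)]
        · simp
        · simp only [Finset.mem_product, Finset.mem_range, not_and_or] at hmn
          omega)
    convert h using 1
    rw [Finset.sum_product_right]
    have h2 : ∀ n : ℕ, ∑ m ∈ Finset.range (k + 1), E ((k, l), (m, n)) =
        lpD α μ n * lpB α μ (k + 1) n k l * (X ^ k * Y ^ l) := by
      intro n
      unfold lpB
      rw [Finset.mul_sum, Finset.sum_mul]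
      refine Finset.sum_congr rfl fun m _ => ?_
      simp only [hE]
      ring
    simp only [h2]
    rw [← Finset.sum_mul, lp_abel_fin α μ (fun n => lpB α μ (k + 1) n k l),
      lpB_zero α μ (k + 1) ((k + 1 : ℕ) : ℤ) k l (by push_cast; omega)]
    have h3 := lpC_eq α μ (k + 1) k l (by omega)
    unfold lpC at h3
    push_cast
    rw [h3]
    ring
  have h4 := hEs.prod_fiberwise hfib
  have a := lpG_hasSum (1 - α) (μ + 1 - α) (μ + 1) X hX
  have b := lpG_hasSum (1 - α) (μ + 1 - α) (μ + 1) Y hY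
  have h5 := lp_two _ _ _ _ a b
  exact h4.unique h5

lemma lp_regroup (α μ : ℂ) (X Y : ℝ) (hX0 : 0 < X) (hX : X < 1) (hY0 : 0 < Y) (hY : Y < 1) :
    ∃ (ρ : ℕ → ℂ) (r : ℝ), 1 < r ∧ (Summable fun k => ‖ρ k‖ * r ^ k) ∧
      (∀ u : ℝ, 0 < u → u < 1 → ∑' k, ρ k * (u : ℂ) ^ k =
        ((1 - u * X) ^ (α - 1) * (1 - u * Y) ^ (α - 1) * ((1 - u * (X * Y)) ^ (α - 1) *
        ((1 - u ^ 2 * (X * Y)) * hyp2F1reg α (α + μ) (μ + 1) (u ^ 2 * (X * Y)))))) ∧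
      ∑' k, ρ k * lpL (μ + 1 - α) (μ + 1) k =
        hyp2F1reg (1 - α) (μ + 1 - α) (μ + 1) X * hyp2F1reg (1 - α) (μ + 1 - α) (μ + 1) Y := by
  have hm : max X Y < 1 := max_lt hX hY
  have hm0 : 0 < max X Y := lt_max_of_lt_left hX0
  obtain ⟨r, hr, hr2⟩ := exists_between ((one_lt_inv₀ hm0).2 hm)
  have hr0 : 0 < r := by linarith
  have hrm : r * max X Y < 1 := by
    rwa [lt_inv_comm₀ hr0 hm0, ← one_div, lt_div_iff₀ hr0, mul_comm] at hr2
  have nX : ‖(X : ℂ)‖ = X := by simp; linarith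
  have nY : ‖(Y : ℂ)‖ = Y := by simp; linarith
  have hsum := lpX_summable α μ X Y r hr
    (by rw [nX]; exact lt_of_le_of_lt (by gcongr; exact le_max_left _ _) hrm)
    (by rw [nY]; exact lt_of_le_of_lt (by gcongr; exact le_max_right _ _) hrm)
  obtain ⟨ρ, h1, h2⟩ := lp_fiber _ _ hr hsum
  refine ⟨ρ, r, hr, h1, fun u hu0 hu1 => ?_, ?_⟩
  · have a := h2 (fun n => (u : ℂ) ^ n) 1 (fun n => by
      rw [norm_pow, one_mul]
      have : ‖(u : ℂ)‖ = u := by simp; linarith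
      rw [this]
      gcongr
      linarith)
    have nu : ‖(u : ℂ)‖ = u := by simp; linarith
    have hXY : X * Y < 1 := by nlinarith
    refine a.unique (lpX_scale α μ X Y u ?_ ?_ ?_ ?_)
    · rw [norm_mul, nu, nX]; nlinarith
    · rw [norm_mul, nu, nY]; nlinarith
    · rw [norm_mul, norm_mul, nu, nX, nY]; nlinarith [mul_pos hX0 hY0]
    · rw [norm_mul, norm_mul, norm_pow, nu, nX, nY]
      have : u ^ 2 < 1 := by nlinarith
      nlinarith [mul_pos hX0 hY0]
  · obtain ⟨M, _, hM⟩ := lpL_bound (μ + 1 - α) (μ + 1) hr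
    exact lpX_pair α μ X Y (by rw [nX]; exact hX) (by rw [nY]; exact hY) _ (h2 _ M hM)

lemma lp_cpow (x : ℝ) (hx : 0 < x) (s : ℂ) : (x : ℂ) ^ s = Complex.exp ((Real.log x : ℝ) * s) := by
  rw [Complex.cpow_def_of_ne_zero (by exact_mod_cast hx.ne'), Complex.ofReal_log hx.le]

lemma lp_legendre (ν μ : ℂ) (w : ℝ) (hw0 : 0 < w) (hw1 : w < 1) :
    legendrePa ν μ ((1 + w) / (1 - w)) = Complex.exp ((Real.log w : ℝ) * (μ / 2)) *
      Complex.exp ((Real.log (1 - w) : ℝ) * (-ν)) * hyp2F1reg (-ν) (-ν + μ) (μ + 1) w := by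
  have h : 1 - w ≠ 0 := by linarith
  unfold legendrePa
  have e1 : ((((1 + w) / (1 - w) : ℝ) : ℂ) - 1) / ((((1 + w) / (1 - w) : ℝ) : ℂ) + 1) = (w : ℂ) := by
    rw [← Complex.ofReal_one, ← Complex.ofReal_sub, ← Complex.ofReal_add, ← Complex.ofReal_div]
    congr 1
    field_simp
    ring
  have e2 : ((((1 + w) / (1 - w) : ℝ) : ℂ) + 1) / 2 = (((1 - w)⁻¹ : ℝ) : ℂ) := by
    rw [show (2 : ℂ) = ((2 : ℝ) : ℂ) by simp,
      ← Complex.ofReal_one, ← Complex.ofReal_add, ← Complex.ofReal_div]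
    congr 1
    field_simp
    ring
  rw [e1, e2, lp_cpow _ hw0, lp_cpow _ (inv_pos.2 (by linarith)), Real.log_inv,
    show μ - ν = -ν + μ by ring]
  push_cast
  ring_nf

lemma lp_point (ν μ : ℂ) (X Y u : ℝ) (hX0 : 0 < X) (hX : X < 1) (hY0 : 0 < Y) (hY : Y < 1)
    (hu0 : 0 < u) (hu : u < 1) (Cv : ℝ)
    (hCv : Cv - 1 = (1 - u) * (1 - u * X) * (1 - u * Y) * (1 - u * (X * Y)) /
      (u * (1 + X) * (1 + Y) * (1 + u ^ 2 * (X * Y)))) :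
    ((4 * (X * Y) * u / (1 - u ^ 2 * (X * Y)) ^ 2 : ℝ) : ℂ) *
      (legendrePa ν μ ((1 + u ^ 2 * (X * Y)) / (1 - u ^ 2 * (X * Y))) * ((Cv : ℂ) - 1) ^ (-ν - 1) *
        (((1 + u ^ 2 * (X * Y)) / (1 - u ^ 2 * (X * Y)) : ℝ) : ℂ) ^ (-ν - 1) *
        ((1 - ((1 + u ^ 2 * (X * Y)) / (1 - u ^ 2 * (X * Y))) ^ 2 : ℝ) : ℂ)⁻¹) =
    -Complex.exp ((Real.log X + Real.log Y : ℝ) * (μ / 2) +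
        (Real.log (1 + X) + Real.log (1 + Y) : ℝ) * (ν + 1)) *
      ((u : ℂ) ^ (ν + μ + 1 - 1) * (1 - (u : ℂ)) ^ (-ν - 1) *
        ((1 - u * X) ^ (-ν - 1) * (1 - u * Y) ^ (-ν - 1) * ((1 - u * (X * Y)) ^ (-ν - 1) *
        ((1 - u ^ 2 * (X * Y)) * hyp2F1reg (-ν) (-ν + μ) (μ + 1) (u ^ 2 * (X * Y)))))) := by
  have hXY0 : 0 < X * Y := mul_pos hX0 hY0
  have hXY : X * Y < 1 := by nlinarith
  have huX : 0 < 1 - u * X := by nlinarith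
  have huY : 0 < 1 - u * Y := by nlinarith
  have huXY : 0 < 1 - u * (X * Y) := by nlinarith
  have hu2 : u ^ 2 < 1 := by nlinarith
  obtain ⟨w, hw⟩ : ∃ w, w = u ^ 2 * (X * Y) := ⟨_, rfl⟩
  have hw0 : 0 < w := by rw [hw]; positivity
  have hw1 : w < 1 := by rw [hw]; nlinarith
  have hu1 : 0 < 1 - u := by linarith
  have hw1' : 0 < 1 - w := by linarith
  have cw : (u : ℂ) ^ 2 * ((X : ℂ) * Y) = (w : ℂ) := by rw [hw]; push_cast; ring
  rw [← hw] at hCv ⊢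
  rw [cw]
  have e1 : ((4 * (X * Y) * u / (1 - w) ^ 2 : ℝ) : ℂ) *
      ((1 - ((1 + w) / (1 - w)) ^ 2 : ℝ) : ℂ)⁻¹ = -((u : ℂ)⁻¹) := by
    rw [← Complex.ofReal_inv, ← Complex.ofReal_mul, ← Complex.ofReal_inv, ← Complex.ofReal_neg]
    congr 1
    have : 1 - ((1 + w) / (1 - w)) ^ 2 = -(4 * w) / (1 - w) ^ 2 := by
      field_simp; ring
    rw [this]
    field_simp
    rw [hw]
    ring
  have eu : ((u : ℂ)⁻¹) = Complex.exp (-(Real.log u : ℝ)) := by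
    rw [Complex.exp_neg, ← Complex.ofReal_exp, Real.exp_log hu0]
  have ew : (1 - (w : ℂ)) = Complex.exp ((Real.log (1 - w) : ℝ)) := by
    rw [← Complex.ofReal_exp, Real.exp_log hw1']; push_cast; ring
  have eC : ((Cv : ℂ) - 1) = ((Cv - 1 : ℝ) : ℂ) := by push_cast; ring
  have c1 : (1 - (u : ℂ)) = ((1 - u : ℝ) : ℂ) := by push_cast; ring
  have c2 : (1 - (u : ℂ) * X) = ((1 - u * X : ℝ) : ℂ) := by push_cast; ring
  have c3 : (1 - (u : ℂ) * Y) = ((1 - u * Y : ℝ) : ℂ) := by push_cast; ring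
  have c4 : (1 - (u : ℂ) * (X * Y)) = ((1 - u * (X * Y) : ℝ) : ℂ) := by push_cast; ring
  have hCpos : 0 < Cv - 1 := by rw [hCv]; positivity
  have lw : Real.log w = 2 * Real.log u + (Real.log X + Real.log Y) := by
    rw [hw, Real.log_mul (by positivity) (by positivity), Real.log_pow,
      Real.log_mul (by positivity) (by positivity)]
    push_cast; ring
  have lC : Real.log (Cv - 1) = Real.log (1 - u) + Real.log (1 - u * X) + Real.log (1 - u * Y) +
      Real.log (1 - u * (X * Y)) - (Real.log u + Real.log (1 + X) + Real.log (1 + Y) +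
      Real.log (1 + w)) := by
    rw [hCv, Real.log_div (by positivity) (by positivity),
      Real.log_mul (by positivity) (by positivity), Real.log_mul (by positivity) (by positivity),
      Real.log_mul (by positivity) (by positivity), Real.log_mul (by positivity) (by positivity),
      Real.log_mul (by positivity) (by positivity), Real.log_mul (by positivity) (by positivity)]
  have lz : Real.log ((1 + w) / (1 - w)) = Real.log (1 + w) - Real.log (1 - w) :=
    Real.log_div (by positivity) (by positivity)
  rw [lp_legendre ν μ w hw0 hw1, eC, c2, c3, c4, lp_cpow _ hCpos, lp_cpow _ (by positivity),
    lp_cpow u hu0, c1, lp_cpow _ hu1, lp_cpow _ huX, lp_cpow _ huY, lp_cpow _ huXY, lC, lz, lw, ew]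
  generalize hyp2F1reg (-ν) (-ν + μ) (μ + 1) (w : ℂ) = H
  calc _ = (((4 * (X * Y) * u / (1 - w) ^ 2 : ℝ) : ℂ) *
      ((1 - ((1 + w) / (1 - w)) ^ 2 : ℝ) : ℂ)⁻¹) * (Complex.exp (((2 * Real.log u + (Real.log X + Real.log Y) : ℝ)) * (μ / 2)) *
      Complex.exp ((Real.log (1 - w) : ℝ) * (-ν)) * Complex.exp ((Real.log (1 - u) + Real.log (1 - u * X) + Real.log (1 - u * Y) +
      Real.log (1 - u * (X * Y)) - (Real.log u + Real.log (1 + X) + Real.log (1 + Y) +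
      Real.log (1 + w)) : ℝ) * (-ν - 1)) * Complex.exp ((Real.log (1 + w) - Real.log (1 - w) : ℝ) * (-ν - 1))) * H := by ring
    _ = _ := by
      rw [e1, eu]
      simp only [neg_mul, ← mul_assoc, ← Complex.exp_add]
      congr 2
      simp only [mul_assoc, ← Complex.exp_add]
      simp only [← mul_assoc, ← Complex.exp_add]
      congr 1
      push_cast
      ring

lemma lp_Cval (X Y u : ℝ) (hX0 : 0 < X) (hX : X < 1) (hY0 : 0 < Y) (hY : Y < 1)
    (hu0 : 0 < u) (hu : u < 1) (z₁ z₂ z₃ : ℝ) (h1 : z₁ = (1 + X) / (1 - X))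
    (h2 : z₂ = (1 + Y) / (1 - Y)) (h3 : z₃ = (1 + u ^ 2 * (X * Y)) / (1 - u ^ 2 * (X * Y))) :
    (1 - z₁ ^ 2 * z₂ ^ 2 - z₁ ^ 2 * z₃ ^ 2 - z₂ ^ 2 * z₃ ^ 2
          + 2 * z₁ ^ 2 * z₂ ^ 2 * z₃ ^ 2) /
        (2 * z₁ * z₂ * z₃ * Real.sqrt ((z₁ ^ 2 - 1) * (z₂ ^ 2 - 1) * (z₃ ^ 2 - 1))) - 1 =
      (1 - u) * (1 - u * X) * (1 - u * Y) * (1 - u * (X * Y)) /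
      (u * (1 + X) * (1 + Y) * (1 + u ^ 2 * (X * Y))) := by
  have hXY0 : 0 < X * Y := mul_pos hX0 hY0
  have hXY : X * Y < 1 := by nlinarith
  have hu2 : u ^ 2 < 1 := by nlinarith
  have hw1 : 0 < 1 - u ^ 2 * (X * Y) := by nlinarith
  have hX1 : 0 < 1 - X := by linarith
  have hY1 : 0 < 1 - Y := by linarith
  obtain ⟨w, hw⟩ : ∃ w, w = u ^ 2 * (X * Y) := ⟨_, rfl⟩
  rw [← hw] at hw1 h3 ⊢
  have hw0 : 0 < w := by rw [hw]; positivity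
  have hs : (z₁ ^ 2 - 1) * (z₂ ^ 2 - 1) * (z₃ ^ 2 - 1) =
      (8 * (X * Y) * u / ((1 - X) * (1 - Y) * (1 - w))) ^ 2 := by
    rw [h1, h2, h3]; field_simp; rw [hw]; ring
  rw [hs, Real.sqrt_sq (by positivity), h1, h2, h3]
  field_simp
  rw [hw]
  ring

lemma lp_sin (ν : ℂ) (h2 : ∀ n : ℕ, ν + 1 ≠ -(n : ℂ)) :
    Complex.sin ((Real.pi : ℂ) * ν) * Complex.Gamma (ν + 1) / (Real.pi : ℂ) = -lpRG (-ν) := by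
  have hG : Complex.Gamma (ν + 1) ≠ 0 := Complex.Gamma_ne_zero h2
  have hpi : (Real.pi : ℂ) ≠ 0 := by exact_mod_cast Real.pi_ne_zero
  have h := Complex.Gamma_mul_Gamma_one_sub (-ν)
  rw [show (1 : ℂ) - -ν = ν + 1 by ring, mul_neg, Complex.sin_neg] at h
  unfold lpRG
  by_cases hs : Complex.sin ((Real.pi : ℂ) * ν) = 0
  · rw [hs] at h ⊢
    simp only [neg_zero, div_zero, mul_eq_zero, hG, or_false] at h
    simp [h]
  · have hm : Complex.Gamma (-ν) ≠ 0 := by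
      intro h0
      rw [h0, zero_mul] at h
      exact div_ne_zero hpi (neg_ne_zero.2 hs) h.symm
    rw [eq_div_iff (neg_ne_zero.2 hs)] at h
    field_simp
    linear_combination -h

lemma lp_image (p : ℝ) (hp0 : 0 < p) (hp : p < 1) :
    (fun u : ℝ => (1 + u ^ 2 * p) / (1 - u ^ 2 * p)) '' Ioo 0 1 = Ioo 1 ((1 + p) / (1 - p)) := by
  ext z
  constructor
  · rintro ⟨u, ⟨h0, h1⟩, rfl⟩
    have hu2 : u ^ 2 < 1 := by nlinarith
    have hu3 : 0 < u ^ 2 * p := by positivity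
    have hu4 : u ^ 2 * p < p := by nlinarith
    have h5 : 0 < 1 - u ^ 2 * p := by linarith
    refine ⟨?_, ?_⟩
    · simp only
      rw [lt_div_iff₀ h5]; linarith
    · simp only
      rw [div_lt_div_iff₀ h5 (by linarith)]; nlinarith
  · rintro ⟨h0, h1⟩
    rw [lt_div_iff₀ (by linarith)] at h1
    have hz : 0 < (z - 1) / (z + 1) / p := by
      apply div_pos (div_pos _ _) hp0 <;> linarith
    refine ⟨Real.sqrt ((z - 1) / (z + 1) / p), ⟨Real.sqrt_pos.2 hz, ?_⟩, ?_⟩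
    · rw [Real.sqrt_lt' one_pos, one_pow, div_lt_one hp0, div_lt_iff₀ (by linarith)]
      linarith
    · simp only
      rw [Real.sq_sqrt hz.le]
      have : z + 1 ≠ 0 := by linarith
      field_simp
      ring

lemma lp_injOn (p : ℝ) (hp0 : 0 < p) (hp : p < 1) :
    InjOn (fun u : ℝ => (1 + u ^ 2 * p) / (1 - u ^ 2 * p)) (Ioo 0 1) := by
  rintro u ⟨h0, h1⟩ v ⟨h2, h3⟩ h
  have a : 0 < 1 - u ^ 2 * p := by nlinarith [show u ^ 2 < 1 by nlinarith]
  have b : 0 < 1 - v ^ 2 * p := by nlinarith [show v ^ 2 < 1 by nlinarith]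
  simp only at h
  rw [div_eq_div_iff a.ne' b.ne'] at h
  have : p * ((u - v) * (u + v)) = 0 := by linarith
  have h4 : u + v ≠ 0 := by linarith
  have := (mul_eq_zero.1 ((mul_eq_zero.1 this).resolve_left hp0.ne')).resolve_right h4
  linarith

lemma lp_deriv (p : ℝ) (hp0 : 0 < p) (hp : p < 1) (u : ℝ) (hu : u ∈ Ioo (0 : ℝ) 1) :
    HasDerivWithinAt (fun u : ℝ => (1 + u ^ 2 * p) / (1 - u ^ 2 * p))
      (4 * p * u / (1 - u ^ 2 * p) ^ 2) (Ioo 0 1) u := by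
  have a : 0 < 1 - u ^ 2 * p := by nlinarith [show u ^ 2 < 1 by nlinarith [hu.1, hu.2]]
  have h1 := ((hasDerivAt_pow 2 u).mul_const p).const_add 1
  have h2 := ((hasDerivAt_pow 2 u).mul_const p).const_sub 1
  have := (h1.div h2 a.ne').hasDerivWithinAt (s := Ioo 0 1)
  refine this.congr_deriv ?_
  field_simp
  push_cast
  ring

/-- Kernel-form product formula for two associated Legendre
functions of the first kind. -/
theorem legendrePP_kernel_product
    (ν μ : ℂ) (h1 : -3 < (ν + μ).re) (h2 : ∀ n : ℕ, ν + 1 ≠ -(n : ℂ))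
    (z₁ z₂ : ℝ) (hz₁ : 1 < z₁) (hz₂ : 1 < z₂)
    (C : ℝ → ℝ)
    (hC : ∀ z₃, C z₃ = (1 - z₁ ^ 2 * z₂ ^ 2 - z₁ ^ 2 * z₃ ^ 2 - z₂ ^ 2 * z₃ ^ 2
          + 2 * z₁ ^ 2 * z₂ ^ 2 * z₃ ^ 2) /
        (2 * z₁ * z₂ * z₃ * Real.sqrt ((z₁ ^ 2 - 1) * (z₂ ^ 2 - 1) * (z₃ ^ 2 - 1))))
    (F : ℝ → ℂ)
    (hF : ∀ z₃, F z₃ = legendrePa ν μ z₃ * ((C z₃ : ℂ) - 1) ^ (-ν - 1) *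
        (z₃ : ℂ) ^ (-ν - 1) * ((1 - z₃ ^ 2 : ℝ) : ℂ)⁻¹)
    (hint : IntegrableOn F (Ioo 1 ((1 + z₁ * z₂) / (z₁ + z₂)))) :
    legendrePa ν μ z₁ * legendrePa ν μ z₂ =
      Complex.sin ((Real.pi : ℂ) * ν) * Complex.Gamma (ν + 1) /
        ((Real.pi : ℂ) * Complex.Gamma (ν + μ + 1) * ((z₁ * z₂ : ℝ) : ℂ) ^ (ν + 1)) *
        ∫ z₃ in Ioo 1 ((1 + z₁ * z₂) / (z₁ + z₂)), F z₃ := by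
  obtain ⟨X, hX0, hX, e1⟩ : ∃ X : ℝ, 0 < X ∧ X < 1 ∧ z₁ = (1 + X) / (1 - X) := by
    refine ⟨(z₁ - 1) / (z₁ + 1), div_pos (by linarith) (by linarith), ?_, ?_⟩
    · rw [div_lt_one (by linarith)]; linarith
    · have : z₁ + 1 ≠ 0 := by linarith
      field_simp; ring
  obtain ⟨Y, hY0, hY, e2⟩ : ∃ Y : ℝ, 0 < Y ∧ Y < 1 ∧ z₂ = (1 + Y) / (1 - Y) := by
    refine ⟨(z₂ - 1) / (z₂ + 1), div_pos (by linarith) (by linarith), ?_, ?_⟩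
    · rw [div_lt_one (by linarith)]; linarith
    · have : z₂ + 1 ≠ 0 := by linarith
      field_simp; ring
  have hXY0 : 0 < X * Y := mul_pos hX0 hY0
  have hXY : X * Y < 1 := by nlinarith
  have hX1 : 0 < 1 - X := by linarith
  have hY1 : 0 < 1 - Y := by linarith
  have ez : (1 + z₁ * z₂) / (z₁ + z₂) = (1 + X * Y) / (1 - X * Y) := by
    rw [div_eq_div_iff (by linarith) (by linarith), e1, e2]
    field_simp; ring
  rw [ez, ← lp_image (X * Y) hXY0 hXY] at hint ⊢
  rw [integrableOn_image_iff_integrableOn_abs_deriv_smul measurableSet_Ioo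
    (lp_deriv (X * Y) hXY0 hXY) (lp_injOn (X * Y) hXY0 hXY)] at hint
  rw [integral_image_eq_integral_abs_deriv_smul measurableSet_Ioo
    (lp_deriv (X * Y) hXY0 hXY) (lp_injOn (X * Y) hXY0 hXY)]
  obtain ⟨ρ, r, hr, hρ, hρu, hρL⟩ := lp_regroup (-ν) μ X Y hX0 hX hY0 hY
  set K : ℂ := -Complex.exp ((Real.log X + Real.log Y : ℝ) * (μ / 2) +
        (Real.log (1 + X) + Real.log (1 + Y) : ℝ) * (ν + 1)) with hK
  have hK0 : K ≠ 0 := neg_ne_zero.2 (Complex.exp_ne_zero _)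
  have hpt : ∀ u ∈ Ioo (0 : ℝ) 1, |4 * (X * Y) * u / (1 - u ^ 2 * (X * Y)) ^ 2| •
      F ((1 + u ^ 2 * (X * Y)) / (1 - u ^ 2 * (X * Y))) =
      K * ((u : ℂ) ^ (ν + μ + 1 - 1) * (1 - (u : ℂ)) ^ (-ν - 1) * ∑' k, ρ k * (u : ℂ) ^ k) := by
    rintro u ⟨hu0, hu1⟩
    rw [abs_of_nonneg (by positivity), Complex.real_smul, hF, hρu u hu0 hu1]
    refine lp_point ν μ X Y u hX0 hX hY0 hY hu0 hu1 _ ?_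
    rw [hC]
    exact lp_Cval X Y u hX0 hX hY0 hY hu0 hu1 z₁ z₂ _ e1 e2 rfl
  rw [setIntegral_congr_fun measurableSet_Ioo hpt, integral_const_mul]
  rw [integrableOn_congr_fun hpt measurableSet_Ioo] at hint
  have hint2 : IntegrableOn (fun u : ℝ => (u : ℂ) ^ (ν + μ + 1 - 1) * (1 - (u : ℂ)) ^ (-ν - 1) *
      ∑' k, ρ k * (u : ℂ) ^ k) (Ioo 0 1) := by
    have := hint.const_mul K⁻¹
    refine IntegrableOn.congr_fun this (fun u _ => ?_) measurableSet_Ioo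
    rw [← mul_assoc, inv_mul_cancel₀ hK0, one_mul]
  have hp := lp_pairing (ν + μ + 1) (-ν) ρ r hr hρ hint2
  rw [show ν + μ + 1 + -ν = μ + 1 by ring] at hp
  rw [show μ + 1 - -ν = ν + μ + 1 by ring] at hρL
  rw [hρL] at hp
  have hnX : ‖(X : ℂ)‖ < 1 := by simp [abs_of_pos hX0, hX]
  have hnY : ‖(Y : ℂ)‖ < 1 := by simp [abs_of_pos hY0, hY]
  have euX := lp_euler_fun (-ν) μ X hnX
  have euY := lp_euler_fun (-ν) μ Y hnY
  rw [show μ + 1 - -ν = ν + μ + 1 by ring, ← Complex.ofReal_one, ← Complex.ofReal_sub,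
    lp_cpow _ hX1] at euX
  rw [show μ + 1 - -ν = ν + μ + 1 by ring, ← Complex.ofReal_one, ← Complex.ofReal_sub,
    lp_cpow _ hY1] at euY
  rw [Complex.ofReal_one] at euX euY
  have hsin := lp_sin ν h2
  have hz : ((z₁ * z₂ : ℝ) : ℂ) ^ (ν + 1) = Complex.exp ((Real.log (1 + X) - Real.log (1 - X) +
      (Real.log (1 + Y) - Real.log (1 - Y)) : ℝ) * (ν + 1)) := by
    rw [lp_cpow _ (by positivity), Real.log_mul (by positivity) (by positivity), e1, e2,
      Real.log_div (by positivity) (by positivity), Real.log_div (by positivity) (by positivity)]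
  rw [hz, e1, e2, lp_legendre ν μ X hX0 hX, lp_legendre ν μ Y hY0 hY, euX, euY]
  generalize (∫ u in Ioo (0 : ℝ) 1, (u : ℂ) ^ (ν + μ + 1 - 1) * (1 - (u : ℂ)) ^ (-ν - 1) *
      ∑' k, ρ k * (u : ℂ) ^ k) = I at *
  generalize hyp2F1reg (1 - -ν) (ν + μ + 1) (μ + 1) X = GX at *
  generalize hyp2F1reg (1 - -ν) (ν + μ + 1) (μ + 1) Y = GY at *
  have rhs : ∀ E : ℂ, Complex.sin ((Real.pi : ℂ) * ν) * Complex.Gamma (ν + 1) /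
        ((Real.pi : ℂ) * Complex.Gamma (ν + μ + 1) * E) * (K * I) = -K * E⁻¹ * (GX * GY) := by
    intro E
    rw [← hp, show -K * E⁻¹ * (lpRG (ν + μ + 1) * lpRG (-ν) * I) =
      K * E⁻¹ * (lpRG (ν + μ + 1) * (-lpRG (-ν)) * I) by ring, ← hsin]
    unfold lpRG
    rw [div_eq_mul_inv, div_eq_mul_inv, mul_inv, mul_inv]
    ring
  rw [rhs, hK, neg_neg, ← Complex.exp_neg]
  rw [show ∀ a b c d e f g h : ℂ, a * b * (c * d) * (e * f * (g * h)) =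
    (a * b * c * e * f * g) * (d * h) by intros; ring]
  simp only [← Complex.exp_add]
  congr 2
  push_cast
  ring
end

section
/- Integral representation for a single associated Legendre function of the second kind. Let ν, μ ∈ ℂ with Re μ > 0 and Re(ν−μ) > −1, and such that ν+μ+1 is not a nonpositive integer, and let z be a real number with z > 1. Assume that the function w ↦ Q_ν^μ(w) · (w−z)^{2μ−1} · (w²−1)^{−μ/2} is absolutely integrable on (z, ∞). Then Q_ν^μ(z) = [Γ(ν+μ+1)] / [Γ(2μ) Γ(ν−μ+1) (z²−1)^{μ/2}] × ∫_z^∞ Q_ν^μ(w) · (w−z)^{2μ−1} · (w²−1)^{−μ/2} dw. -/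
open MeasureTheory Set

/-- coefficient of the regularized series -/
noncomputable def hypCoef (a b c : ℂ) (n : ℕ) : ℂ :=
  (ascPochhammer ℂ n).eval a * (ascPochhammer ℂ n).eval b /
      (Complex.Gamma (c + n) * (n.factorial : ℂ))

theorem hypCoef_summable (a b c x : ℂ) (hx : ‖x‖ < 1) :
    Summable (fun n => ‖hypCoef a b c n * x ^ n‖) := by
  have h1 := Complex.radius_regularizedGaussHGFunSeries_ge_one a b c
  have h2 : x ∈ Metric.eball (0 : ℂ) (Complex.regularizedGaussHGFunSeries a b c).radius := by
    apply Metric.eball_subset_eball h1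
    rw [← ENNReal.ofReal_one, Metric.eball_ofReal]
    simpa using hx
  have h3 := FormalMultilinearSeries.summable_norm_apply _ h2
  refine h3.congr fun n => ?_
  rw [FormalMultilinearSeries.apply_eq_prod_smul_coeff,
    Complex.coeff_regularizedGaussHGFunSeries]
  simp [hypCoef]
  ring

theorem hypCoef_succ (a b c : ℂ) (n : ℕ) (hc : c + n ≠ 0) :
    ((n : ℂ) + 1) * (n + c) * hypCoef a b c (n + 1) = (n + a) * (n + b) * hypCoef a b c n := by
  unfold hypCoef
  rw [ascPochhammer_succ_eval, ascPochhammer_succ_eval]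
  push_cast [Nat.factorial_succ]
  rw [← add_assoc, Complex.Gamma_add_one _ hc]
  have h1 : (n : ℂ) + 1 ≠ 0 := by exact_mod_cast Nat.succ_ne_zero n
  have h2 : (n.factorial : ℂ) ≠ 0 := by exact_mod_cast Nat.factorial_ne_zero n
  rcases eq_or_ne (Complex.Gamma (c + n)) 0 with h0 | h0
  · simp [h0]
  field_simp
  ring

/-- coefficients of `(1-x)^p` -/
noncomputable def binCoef (p : ℂ) (n : ℕ) : ℂ := Ring.choose p n * (-1) ^ n

theorem binCoef_succ (p : ℂ) (n : ℕ) :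
    ((n : ℂ) + 1) * binCoef p (n + 1) = (n - p) * binCoef p n := by
  have h1 := Ring.descPochhammer_eq_factorial_smul_choose p n
  have h2 := Ring.descPochhammer_eq_factorial_smul_choose p (n + 1)
  rw [descPochhammer_succ_right, Polynomial.smeval_mul, h1] at h2
  simp [Polynomial.smeval_natCast, Nat.factorial_succ] at h2
  have h3 : (n.factorial : ℂ) ≠ 0 := by exact_mod_cast Nat.factorial_ne_zero n
  unfold binCoef
  apply mul_left_cancel₀ h3
  rw [pow_succ]
  linear_combination (-1) ^ n * h2

theorem binCoef_hasSum (p x : ℂ) (hx : ‖x‖ < 1) :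
    Summable (fun n => ‖binCoef p n * x ^ n‖) ∧
      HasSum (fun n => binCoef p n * x ^ n) ((1 - x) ^ p) := by
  have h1 := Complex.one_add_cpow_hasFPowerSeriesOnBall_zero (a := p)
  have h2 : -x ∈ Metric.eball (0 : ℂ) 1 := by
    rw [← ENNReal.ofReal_one, Metric.eball_ofReal]
    simpa using hx
  have h3 := h1.hasSum h2
  have h4 := FormalMultilinearSeries.summable_norm_apply _
    (Metric.eball_subset_eball h1.r_le h2)
  have e : ∀ n, (binomialSeries ℂ p n fun _ => -x) = binCoef p n * x ^ n := by
    intro n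
    rw [binomialSeries_apply]
    simp [binCoef, neg_pow x n, mul_assoc]
  simp only [e] at h3 h4
  refine ⟨h4, ?_⟩
  simpa [sub_eq_add_neg] using h3

section PS
open PowerSeries

theorem coeff_ode (f : PowerSeries ℂ) (c s q : ℂ) (n : ℕ) :
    coeff n (X * (1 - X) * derivative ℂ (derivative ℂ f) + (C c - C s * X) * derivative ℂ f - C q * f)
     = ((n : ℂ) + 1) * (n + c) * coeff (n + 1) f - (n * (n - 1) + s * n + q) * coeff n f := by
  have e : X * (1 - X) * derivative ℂ (derivative ℂ f) + (C c - C s * X) * derivative ℂ f - C q * f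
    = X * derivative ℂ (derivative ℂ f) - X * (X * derivative ℂ (derivative ℂ f))
      + C c * derivative ℂ f - C s * (X * derivative ℂ f) - C q * f := by ring
  rw [e]
  rcases n with _ | _ | n
  · have := coeff_derivative f 0
    simp at this
    simp [this]
  · simp [coeff_derivative, coeff_succ_X_mul, coeff_zero_X_mul]
    ring
  · simp [coeff_derivative, coeff_succ_X_mul]
    ring

theorem ps_euler (f h : PowerSeries ℂ) (c A B : ℂ)
    (hf : X * (1 - X) * derivative ℂ (derivative ℂ f) +
      (C c - C (A + B + 1) * X) * derivative ℂ f - C (A * B) * f = 0)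
    (hh : (1 - X) * derivative ℂ h = - C (A + B - c) * h) :
    X * (1 - X) * derivative ℂ (derivative ℂ (h * f)) +
      (C c - C ((c - A) + (c - B) + 1) * X) * derivative ℂ (h * f)
        - C ((c - A) * (c - B)) * (h * f) = 0 := by
  have hh2 := congrArg (derivative ℂ) hh
  have h1X : (1 - X : PowerSeries ℂ) ≠ 0 := by
    intro h0
    have := congrArg (constantCoeff (R := ℂ)) h0
    simp at this
  apply mul_left_cancel₀ h1X
  have d1 : derivative ℂ (1 - X : PowerSeries ℂ) = -1 := by simp
  have d2 : derivative ℂ (-C (A + B - c) : PowerSeries ℂ) = 0 := by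
    rw [← map_neg, derivative_C]
  simp only [Derivation.leibniz, smul_eq_mul, map_add, d1, d2] at hh2 ⊢
  simp only [map_add, map_sub, map_mul, map_one] at hf hh hh2 ⊢
  generalize derivative ℂ (derivative ℂ f) = f2 at *
  generalize derivative ℂ (derivative ℂ h) = h2 at *
  generalize derivative ℂ f = f1 at *
  generalize derivative ℂ h = h1 at *
  generalize (C A : PowerSeries ℂ) = A at *
  generalize (C B : PowerSeries ℂ) = B at *
  generalize (C c : PowerSeries ℂ) = c at *
  linear_combination (1 - X) * h * hf + X * f * (1 - X) * hh2 + 2 * X * (1 - X) * f1 * hh +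
    (c - ((c - A) + (c - B) + 1) * X) * f * hh + X * f * (1 - (A + B - c)) * hh
end PS

theorem cauchy_coef (A B c : ℂ) (hc : ∀ n : ℕ, c + n ≠ 0) (n : ℕ) :
    ∑ kl ∈ Finset.HasAntidiagonal.antidiagonal n, binCoef (A + B - c) kl.1 * hypCoef A B c kl.2
      = hypCoef (c - A) (c - B) c n := by
  set f : PowerSeries ℂ := PowerSeries.mk (hypCoef A B c) with hf
  set h : PowerSeries ℂ := PowerSeries.mk (binCoef (A + B - c)) with hh
  have H := ps_euler f h c A B (by
    ext n
    rw [coeff_ode, hf, PowerSeries.coeff_mk, PowerSeries.coeff_mk, hypCoef_succ _ _ _ _ (hc n)]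
    simp; ring) (by
    ext n
    have := binCoef_succ (A + B - c) n
    rw [sub_mul, one_mul, ← map_neg, PowerSeries.coeff_C_mul, map_sub,
      PowerSeries.coeff_derivative]
    rcases n with _ | n
    · simp only [hh, PowerSeries.coeff_zero_X_mul, PowerSeries.coeff_mk]
      linear_combination this
    · simp only [PowerSeries.coeff_derivative, hh, PowerSeries.coeff_succ_X_mul,
        PowerSeries.coeff_mk]
      push_cast at this ⊢
      linear_combination this)
  have R : ∀ n, PowerSeries.coeff n (h * f) = hypCoef (c - A) (c - B) c n := by
    intro n
    induction n with
    | zero => simp [hh, hf, binCoef, hypCoef]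
    | succ n ih =>
      have := congrArg (PowerSeries.coeff n) H
      rw [coeff_ode, ih] at this
      have r := hypCoef_succ (c - A) (c - B) c n (hc n)
      have h1 : (n : ℂ) + 1 ≠ 0 := by exact_mod_cast Nat.succ_ne_zero n
      have h2 : (n : ℂ) + c ≠ 0 := by rw [add_comm]; exact hc n
      apply mul_left_cancel₀ (mul_ne_zero h1 h2)
      simp only [map_zero] at this
      linear_combination this - r
  rw [← R n, PowerSeries.coeff_mul]
  simp [hh, hf]

theorem hyp_euler (a b c x : ℂ) (hc : ∀ n : ℕ, c + n ≠ 0) (hx : ‖x‖ < 1) :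
    hyp2F1reg a b c x = (1 - x) ^ (c - a - b) * hyp2F1reg (c - a) (c - b) c x := by
  obtain ⟨s1, s2⟩ := binCoef_hasSum (c - a - b) x hx
  have s3 := hypCoef_summable (c - a) (c - b) c x hx
  have e := tsum_mul_tsum_eq_tsum_sum_antidiagonal_of_summable_norm s1 s3
  rw [s2.tsum_eq] at e
  change _ = _ * ∑' n, hypCoef (c - a) (c - b) c n * x ^ n
  rw [e]
  change ∑' n, hypCoef a b c n * x ^ n = _
  refine tsum_congr fun n => ?_
  have := cauchy_coef (c - a) (c - b) c hc n
  rw [show c - a + (c - b) - c = c - a - b by ring, show c - (c - a) = a by ring,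
    show c - (c - b) = b by ring] at this
  rw [← this, Finset.sum_mul]
  refine Finset.sum_congr rfl fun kl hkl => ?_
  rw [← Finset.HasAntidiagonal.mem_antidiagonal.1 hkl, pow_add]
  ring

theorem gamma_dup (s : ℂ) (hs : 0 < s.re) (n : ℕ) :
    Complex.Gamma (s + 2 * n) = 4 ^ n * (ascPochhammer ℂ n).eval (s / 2) *
      (ascPochhammer ℂ n).eval ((s + 1) / 2) * Complex.Gamma s := by
  induction n with
  | zero => simp
  | succ n ih =>
    have h1 : s + 2 * n ≠ 0 := by
      intro h0
      have := congrArg Complex.re h0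
      simp at this
      have : (0 : ℝ) ≤ n := n.cast_nonneg
      linarith
    have h2 : s + 2 * n + 1 ≠ 0 := by
      intro h0
      have := congrArg Complex.re h0
      simp at this
      have : (0 : ℝ) ≤ n := n.cast_nonneg
      linarith
    rw [show s + 2 * ((n + 1 : ℕ) : ℂ) = s + 2 * n + 1 + 1 by push_cast; ring,
      Complex.Gamma_add_one _ h2, Complex.Gamma_add_one _ h1, ih,
      ascPochhammer_succ_eval, ascPochhammer_succ_eval]
    ring

theorem image_div (z : ℝ) (hz : 0 < z) : (fun t : ℝ => z / t) '' Ioo 0 1 = Ioi z := by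
  ext w
  simp only [mem_image, mem_Ioo, mem_Ioi]
  constructor
  · rintro ⟨t, ⟨h0, h1⟩, rfl⟩
    rw [lt_div_iff₀ h0]
    nlinarith
  · intro hw
    have hw0 : 0 < w := hz.trans hw
    exact ⟨z / w, ⟨by positivity, (div_lt_one hw0).2 hw⟩, by field_simp⟩

theorem beta_aux (σ v : ℂ) (z : ℝ) (hz : 0 < z) (t : ℝ) (ht : t ∈ Ioo (0 : ℝ) 1) :
    |-z / t ^ 2| • (((z / t : ℝ) : ℂ) ^ (-σ) * ((z / t - z : ℝ) : ℂ) ^ (v - 1)) =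
      (z : ℂ) ^ (v - σ) * ((t : ℂ) ^ (σ - v - 1) * (1 - (t : ℂ)) ^ (v - 1)) := by
  obtain ⟨h0, h1⟩ := ht
  have h2 : z / t - z = z * (1 - t) / t := by field_simp
  have h3 : |-z / t ^ 2| = z / t ^ 2 := by rw [neg_div, abs_neg, abs_of_pos (by positivity)]
  have h1' : 0 < 1 - t := by linarith
  have L : ∀ x : ℝ, 0 < x → ∀ y : ℂ, (x : ℂ) ^ y = Complex.exp (Real.log x * y) := by
    intro x hx y
    rw [Complex.cpow_def_of_ne_zero (by exact_mod_cast hx.ne'), Complex.ofReal_log hx.le]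
  have e1 : ((z / t ^ 2 : ℝ) : ℂ) = Complex.exp (Real.log z - 2 * Real.log t) := by
    rw [← Real.exp_log (show 0 < z / t ^ 2 by positivity), Real.log_div hz.ne' (by positivity),
      Real.log_pow]
    push_cast
    rfl
  rw [h2, h3, Complex.real_smul, e1, L _ (by positivity), L _ (by positivity), L z hz, L t h0,
    show (1 - (t : ℂ)) = ((1 - t : ℝ) : ℂ) by push_cast; rfl, L _ h1',
    Real.log_div hz.ne' h0.ne', Real.log_div (by positivity) h0.ne', Real.log_mul hz.ne' h1'.ne',
    ← Complex.exp_add, ← Complex.exp_add, ← Complex.exp_add, ← Complex.exp_add]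
  congr 1
  push_cast
  ring

theorem beta_int (σ v : ℂ) (z : ℝ) (hz : 0 < z) (hv : 0 < v.re) (hs : 0 < (σ - v).re) :
    IntegrableOn (fun w : ℝ => (w : ℂ) ^ (-σ) * ((w - z : ℝ) : ℂ) ^ (v - 1)) (Ioi z) ∧
    ∫ w in Ioi z, (w : ℂ) ^ (-σ) * ((w - z : ℝ) : ℂ) ^ (v - 1) =
      (z : ℂ) ^ (v - σ) * Complex.betaIntegral (σ - v) v := by
  have hd : ∀ x ∈ Ioo (0 : ℝ) 1,
      HasDerivWithinAt (fun t : ℝ => z / t) (-z / x ^ 2) (Ioo 0 1) x := by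
    intro x hx
    have := ((hasDerivAt_id x).fun_inv hx.1.ne').const_mul z
    refine HasDerivAt.hasDerivWithinAt ?_
    have e : z * (-1 / id x ^ 2) = -z / x ^ 2 := by simp only [id]; ring
    rw [e] at this
    exact this
  have hi : InjOn (fun t : ℝ => z / t) (Ioo 0 1) := by
    intro x hx y hy hxy
    have := hx.1.ne'
    have := hy.1.ne'
    simp only at hxy
    field_simp at hxy
    exact hxy.symm
  have hb := Complex.betaIntegral_convergent hs hv
  rw [intervalIntegrable_iff_integrableOn_Ioo_of_le zero_le_one] at hb
  rw [← image_div z hz, integrableOn_image_iff_integrableOn_abs_deriv_smul measurableSet_Ioo hd hi,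
    integral_image_eq_integral_abs_deriv_smul measurableSet_Ioo hd hi]
  constructor
  · refine IntegrableOn.congr_fun (f := fun t : ℝ => (z : ℂ) ^ (v - σ) *
      ((t : ℂ) ^ (σ - v - 1) * (1 - (t : ℂ)) ^ (v - 1))) (hb.const_mul ((z : ℂ) ^ (v - σ)))
      (fun t ht => (beta_aux σ v z hz t ht).symm) measurableSet_Ioo
  · rw [setIntegral_congr_fun measurableSet_Ioo (fun t ht => beta_aux σ v z hz t ht),
      integral_const_mul, Complex.betaIntegral, intervalIntegral.integral_of_le zero_le_one,
      integral_Ioc_eq_integral_Ioo]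

theorem integral_series (a b c σ v : ℂ) (z : ℝ) (hz : 1 < z) (hv : 0 < v.re)
    (hs : 0 < (σ - v).re) :
    ∫ w in Ioi z, (w : ℂ) ^ (-σ) * ((w - z : ℝ) : ℂ) ^ (v - 1) * hyp2F1reg a b c (1 / (w : ℂ) ^ 2)
      = ∑' n : ℕ, hypCoef a b c n *
        ((z : ℂ) ^ (v - (σ + 2 * n)) * Complex.betaIntegral (σ + 2 * n - v) v) := by
  have hz0 : 0 < z := by linarith
  let G : ℕ → ℝ → ℂ := fun n w => hypCoef a b c n *
    ((w : ℂ) ^ (-(σ + 2 * n)) * ((w - z : ℝ) : ℂ) ^ (v - 1))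
  have hs' : ∀ n : ℕ, 0 < (σ + 2 * n - v).re := by
    intro n
    have : (0 : ℝ) ≤ n := n.cast_nonneg
    simp at hs ⊢
    linarith
  have hB : ∀ n : ℕ, _ := fun n => beta_int (σ + 2 * n) v z hz0 hv (hs' n)
  have hB0 := beta_int σ v z hz0 hv hs
  have hGi : ∀ n, Integrable (G n) (volume.restrict (Ioi z)) := fun n => (hB n).1.const_mul _
  have epow : ∀ (n : ℕ) (w : ℝ), 0 < w →
      (w : ℂ) ^ (-(σ + 2 * n)) = (w : ℂ) ^ (-σ) * (1 / (w : ℂ) ^ 2) ^ n := by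
    intro n w hw
    have hw' : (w : ℂ) ≠ 0 := by exact_mod_cast hw.ne'
    rw [neg_add, Complex.cpow_add _ _ hw', Complex.cpow_neg _ (2 * (n : ℂ)), one_div, inv_pow,
      ← pow_mul, ← Complex.cpow_natCast]
    push_cast
    rfl
  have hbd : ∀ n, ∫ w in Ioi z, ‖G n w‖ ≤ ‖hypCoef a b c n * (1 / (z : ℂ) ^ 2) ^ n‖ *
      ∫ w in Ioi z, ‖(w : ℂ) ^ (-σ) * ((w - z : ℝ) : ℂ) ^ (v - 1)‖ := by
    intro n
    rw [← integral_const_mul]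
    refine setIntegral_mono_on (hGi n).norm (hB0.1.norm.const_mul _) measurableSet_Ioi ?_
    intro w hw
    have hw0 : 0 < w := hz0.trans hw
    simp only [G]
    rw [epow n w hw0, show hypCoef a b c n * ((w : ℂ) ^ (-σ) * (1 / (w : ℂ) ^ 2) ^ n *
      ((w - z : ℝ) : ℂ) ^ (v - 1)) = (hypCoef a b c n * (1 / (w : ℂ) ^ 2) ^ n) *
      ((w : ℂ) ^ (-σ) * ((w - z : ℝ) : ℂ) ^ (v - 1)) by ring, norm_mul (hypCoef a b c n * _)]
    refine mul_le_mul_of_nonneg_right ?_ (norm_nonneg _)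
    rw [norm_mul, norm_mul]
    refine mul_le_mul_of_nonneg_left ?_ (norm_nonneg _)
    simp only [norm_pow, norm_div, norm_one, Complex.norm_real, Real.norm_eq_abs, sq_abs]
    have hzw : z ≤ w := le_of_lt hw
    gcongr
  have hx : ‖(1 / (z : ℂ) ^ 2)‖ < 1 := by
    simp only [norm_pow, norm_div, norm_one, Complex.norm_real, Real.norm_eq_abs, sq_abs]
    rw [div_lt_one (by positivity)]
    nlinarith
  have hsum : Summable fun n => ∫ w in Ioi z, ‖G n w‖ :=
    Summable.of_nonneg_of_le (fun n => integral_nonneg fun _ => norm_nonneg _) hbd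
      ((hypCoef_summable a b c _ hx).mul_right _)
  have key := integral_tsum_of_summable_integral_norm hGi hsum
  have e1 : ∀ n, ∫ w in Ioi z, G n w = hypCoef a b c n *
        ((z : ℂ) ^ (v - (σ + 2 * n)) * Complex.betaIntegral (σ + 2 * n - v) v) := by
    intro n
    rw [← (hB n).2, ← integral_const_mul]
  rw [← tsum_congr e1, key]
  refine setIntegral_congr_fun measurableSet_Ioi fun w hw => ?_
  have hw0 : 0 < w := hz0.trans hw
  change _ * ∑' n, hypCoef a b c n * _ ^ n = _
  rw [← tsum_mul_left]
  refine tsum_congr fun n => ?_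
  simp only [G]
  rw [epow n w hw0]
  ring

/-- Integral representation for a single associated Legendre
function of the second kind. -/
theorem legendreQ_single_integral
    (ν μ : ℂ) (hμ : 0 < μ.re) (hνμ : -1 < (ν - μ).re)
    (h : ∀ n : ℕ, ν + μ + 1 ≠ -(n : ℂ))
    (z : ℝ) (hz : 1 < z)
    (F : ℝ → ℂ)
    (hF : ∀ w, F w = legendreQ ν μ w * ((w - z : ℝ) : ℂ) ^ (2 * μ - 1) *
        ((w ^ 2 - 1 : ℝ) : ℂ) ^ (-μ / 2))
    (hint : IntegrableOn F (Ioi z)) :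
    legendreQ ν μ z =
      Complex.Gamma (ν + μ + 1) /
        (Complex.Gamma (2 * μ) * Complex.Gamma (ν - μ + 1) *
          ((z ^ 2 - 1 : ℝ) : ℂ) ^ (μ / 2)) *
        ∫ w in Ioi z, F w := by
  have hz0 : 0 < z := by linarith
  have hzc : (z : ℂ) ≠ 0 := by exact_mod_cast hz0.ne'
  have hre : -1 < ν.re - μ.re := by simpa using hνμ
  have hs : 0 < (ν + μ + 1).re := by simp; linarith
  have ht : 0 < (ν - μ + 1).re := by simp; linarith
  have h2μ : 0 < (2 * μ).re := by simp; linarith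
  have hc : ∀ n : ℕ, ν + 3 / 2 + n ≠ 0 := by
    intro n h0
    have h1 := congrArg Complex.re h0
    have : (0 : ℝ) ≤ n := n.cast_nonneg
    norm_num at h1
    linarith
  have hGs := Complex.Gamma_ne_zero_of_re_pos hs
  have hGt := Complex.Gamma_ne_zero_of_re_pos ht
  have hGm := Complex.Gamma_ne_zero_of_re_pos h2μ
  set K : ℂ := (Real.sqrt Real.pi : ℂ) * Complex.exp ((Real.pi : ℂ) * Complex.I * μ) *
    Complex.Gamma (ν + μ + 1) * (2 : ℂ) ^ (-ν - 1) with hK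
  have hFw : ∀ w ∈ Ioi z, F w = K * ((w : ℂ) ^ (-(ν + μ + 1)) *
      ((w - z : ℝ) : ℂ) ^ (2 * μ - 1) * hyp2F1reg ((ν + μ + 1) / 2) ((ν + μ + 2) / 2) (ν + 3 / 2)
        (1 / (w : ℂ) ^ 2)) := by
    intro w hw
    have hw1 : 0 < w ^ 2 - 1 := by
      have : z < w := hw
      nlinarith
    have hw2 : ((w : ℂ) ^ 2 - 1) ≠ 0 := by exact_mod_cast hw1.ne'
    have hone : ((w : ℂ) ^ 2 - 1) ^ (μ / 2) * ((w : ℂ) ^ 2 - 1) ^ (-μ / 2) = 1 := by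
      rw [← Complex.cpow_add _ _ hw2, show μ / 2 + -μ / 2 = 0 by ring, Complex.cpow_zero]
    rw [hF, legendreQ, show ((w ^ 2 - 1 : ℝ) : ℂ) = (w : ℂ) ^ 2 - 1 by push_cast; rfl,
      show -ν - μ - 1 = -(ν + μ + 1) by ring, hK]
    linear_combination (Real.sqrt Real.pi : ℂ) * Complex.exp ((Real.pi : ℂ) * Complex.I * μ) *
      Complex.Gamma (ν + μ + 1) * (2 : ℂ) ^ (-ν - 1) * ((w : ℂ) ^ (-(ν + μ + 1)) *
      ((w - z : ℝ) : ℂ) ^ (2 * μ - 1) * hyp2F1reg ((ν + μ + 1) / 2) ((ν + μ + 2) / 2) (ν + 3 / 2)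
        (1 / (w : ℂ) ^ 2)) * hone
  rw [setIntegral_congr_fun measurableSet_Ioi hFw, integral_const_mul,
    integral_series _ _ _ _ _ z hz h2μ
      (by rw [show ν + μ + 1 - 2 * μ = ν - μ + 1 by ring]; exact ht)]
  have hterm : ∀ n : ℕ, hypCoef ((ν + μ + 1) / 2) ((ν + μ + 2) / 2) (ν + 3 / 2) n *
        ((z : ℂ) ^ (2 * μ - (ν + μ + 1 + 2 * n)) *
          Complex.betaIntegral (ν + μ + 1 + 2 * n - 2 * μ) (2 * μ)) =
      (Complex.Gamma (2 * μ) * Complex.Gamma (ν - μ + 1) / Complex.Gamma (ν + μ + 1) *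
        (z : ℂ) ^ (2 * μ - (ν + μ + 1))) *
      (hypCoef ((ν - μ + 1) / 2) ((ν - μ + 2) / 2) (ν + 3 / 2) n * (1 / (z : ℂ) ^ 2) ^ n) := by
    intro n
    have hn : (0 : ℝ) ≤ n := n.cast_nonneg
    have r1 : 0 < (ν - μ + 1 + 2 * n).re := by simp at ht ⊢; linarith
    have r2 : 0 < (ν + μ + 1 + 2 * n).re := by simp at hs ⊢; linarith
    have b := Complex.Gamma_mul_Gamma_eq_betaIntegral r1 h2μ
    rw [show ν - μ + 1 + 2 * n + 2 * μ = ν + μ + 1 + 2 * (n : ℂ) by ring] at b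
    have d1 := gamma_dup _ hs n
    have d2 := gamma_dup _ ht n
    have g1 := Complex.Gamma_ne_zero_of_re_pos r2
    rw [show ν + μ + 1 + 1 = ν + μ + 2 by ring] at d1
    rw [show ν - μ + 1 + 1 = ν - μ + 2 by ring] at d2
    rw [show ν + μ + 1 + 2 * n - 2 * μ = ν - μ + 1 + 2 * (n : ℂ) by ring]
    have b' : Complex.betaIntegral (ν - μ + 1 + 2 * n) (2 * μ) =
      Complex.Gamma (ν - μ + 1 + 2 * n) * Complex.Gamma (2 * μ) /
        Complex.Gamma (ν + μ + 1 + 2 * n) := by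
      rw [b, mul_div_cancel_left₀ _ g1]
    have p : (z : ℂ) ^ (2 * μ - (ν + μ + 1 + 2 * n)) =
        (z : ℂ) ^ (2 * μ - (ν + μ + 1)) * (1 / (z : ℂ) ^ 2) ^ n := by
      rw [show 2 * μ - (ν + μ + 1 + 2 * n) = 2 * μ - (ν + μ + 1) + -(2 * (n : ℂ)) by ring,
        Complex.cpow_add _ _ hzc, Complex.cpow_neg _ (2 * (n : ℂ)), one_div, inv_pow,
        ← pow_mul, ← Complex.cpow_natCast]
      push_cast
      rfl
    rw [b', p, d2]
    rw [d1] at g1 ⊢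
    unfold hypCoef
    generalize (z : ℂ) ^ (2 * μ - (ν + μ + 1)) = Z
    generalize (1 / (z : ℂ) ^ 2) ^ n = Y
    generalize Complex.Gamma (ν + 3 / 2 + n) * (n.factorial : ℂ) = D
    have q1 : (ascPochhammer ℂ n).eval ((ν + μ + 1) / 2) ≠ 0 := by
      intro h0; simp [h0] at g1
    have q2 : (ascPochhammer ℂ n).eval ((ν + μ + 2) / 2) ≠ 0 := by
      intro h0; simp [h0] at g1
    rcases eq_or_ne D 0 with hD | hD
    · simp [hD]
    field_simp
  rw [tsum_congr hterm, tsum_mul_left]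
  have hx : ‖(1 / (z : ℂ) ^ 2)‖ < 1 := by
    simp only [norm_pow, norm_div, norm_one, Complex.norm_real, Real.norm_eq_abs, sq_abs]
    rw [div_lt_one (by positivity)]
    nlinarith
  have E := hyp_euler ((ν - μ + 1) / 2) ((ν - μ + 2) / 2) (ν + 3 / 2) (1 / (z : ℂ) ^ 2) hc hx
  rw [show ν + 3 / 2 - (ν - μ + 1) / 2 - (ν - μ + 2) / 2 = μ by ring,
    show ν + 3 / 2 - (ν - μ + 1) / 2 = (ν + μ + 2) / 2 by ring,
    show ν + 3 / 2 - (ν - μ + 2) / 2 = (ν + μ + 1) / 2 by ring] at E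
  have sym : hyp2F1reg ((ν + μ + 2) / 2) ((ν + μ + 1) / 2) (ν + 3 / 2) (1 / (z : ℂ) ^ 2) =
      hyp2F1reg ((ν + μ + 1) / 2) ((ν + μ + 2) / 2) (ν + 3 / 2) (1 / (z : ℂ) ^ 2) := by
    unfold hyp2F1reg
    refine tsum_congr fun n => ?_
    ring
  rw [sym] at E
  change _ = _ * (K * (_ * hyp2F1reg ((ν - μ + 1) / 2) ((ν - μ + 2) / 2) (ν + 3 / 2)
    (1 / (z : ℂ) ^ 2)))
  rw [E, legendreQ, show ((z ^ 2 - 1 : ℝ) : ℂ) = (z : ℂ) ^ 2 - 1 by push_cast; rfl]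
  have hz1 : 0 < z ^ 2 - 1 := by nlinarith
  have hz2 : ((z : ℂ) ^ 2 - 1) ≠ 0 := by exact_mod_cast hz1.ne'
  have hP : ((z : ℂ) ^ 2 - 1) ^ (μ / 2) ≠ 0 := by
    rw [Complex.cpow_def_of_ne_zero hz2]; exact Complex.exp_ne_zero _
  have hpow : (z : ℂ) ^ (2 * μ - (ν + μ + 1)) * (1 - 1 / (z : ℂ) ^ 2) ^ μ =
      (z : ℂ) ^ (-ν - μ - 1) * (((z : ℂ) ^ 2 - 1) ^ (μ / 2) * ((z : ℂ) ^ 2 - 1) ^ (μ / 2)) := by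
    have L : ∀ x : ℝ, 0 < x → ∀ y : ℂ, (x : ℂ) ^ y = Complex.exp (Real.log x * y) := by
      intro x hx y
      rw [Complex.cpow_def_of_ne_zero (by exact_mod_cast hx.ne'), Complex.ofReal_log hx.le]
    have e2 : (1 - 1 / (z : ℂ) ^ 2) = (((z ^ 2 - 1) / z ^ 2 : ℝ) : ℂ) := by
      push_cast
      field_simp
    rw [e2, show (z : ℂ) ^ 2 - 1 = ((z ^ 2 - 1 : ℝ) : ℂ) by push_cast; rfl,
      L z hz0, L z hz0, L _ hz1, L _ (by positivity), Real.log_div hz1.ne' (by positivity),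
      Real.log_pow, ← Complex.exp_add, ← Complex.exp_add, ← Complex.exp_add]
    congr 1
    push_cast
    ring
  have hpow' : ∀ H : ℂ, (z : ℂ) ^ (2 * μ - (ν + μ + 1)) * ((1 - 1 / (z : ℂ) ^ 2) ^ μ * H) =
      (z : ℂ) ^ (-ν - μ - 1) * (((z : ℂ) ^ 2 - 1) ^ (μ / 2) * ((z : ℂ) ^ 2 - 1) ^ (μ / 2)) * H := by
    intro H
    rw [← mul_assoc, hpow]
  rw [mul_assoc (_ / _) ((z : ℂ) ^ (2 * μ - (ν + μ + 1))), hpow', hK]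
  generalize hyp2F1reg _ _ _ _ = H
  generalize Complex.Gamma (2 * μ) = G2 at hGm ⊢
  field_simp
end

section
/- Integral representation for a single Gegenbauer function of the first kind in the hyperbolic context. Let λ, α ∈ ℂ with Re(λ+2α) > 0 and Re(λ+α) < 0, with λ ∉ ℤ, and such that 2λ+2α+1 is not a nonpositive integer, and let z be a real number with z > 1. Assume that the function w ↦ C_λ^α(w) · (w²−1)^{(λ+2α−2)/2} · (2z²w² − z² − w² − 2zw√((z²−1)(w²−1)))^{−(2λ+2α+1)/2} is absolutely integrable on (1, z) (note 2z²w² − z² − w² − 2zw√((z²−1)(w²−1)) > 0 for 1 < w < z). Then C_λ^α(z) = [sin(2π(λ+α)) Γ(2λ+2α+1) (z²−1)^{(λ+1)/2}] / [sin(πλ) Γ(λ+1) Γ(λ+2α)] × ∫_1^z C_λ^α(w) · (w²−1)^{(λ+2α−2)/2} / (2z²w² − z² − w² − 2zw√((z²−1)(w²−1)))^{(2λ+2α+1)/2} dw. -/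
open MeasureTheory Set

noncomputable def poc (a : ℂ) (n : ℕ) : ℂ := (ascPochhammer ℂ n).eval a

lemma poc_zero (a : ℂ) : poc a 0 = 1 := by simp [poc]
lemma poc_succ (a : ℂ) (n : ℕ) : poc a (n+1) = poc a n * (a + n) := by
  simp [poc, ascPochhammer_succ_eval]
lemma poc_add (a : ℂ) (m n : ℕ) : poc a (m+n) = poc a m * poc (a + m) n := by
  induction n with
  | zero => simp [poc_zero]
  | succ n ih => rw [← add_assoc, poc_succ, poc_succ, ih]; push_cast; ring
lemma poc_succ_left (a : ℂ) (n : ℕ) : poc a (n+1) = a * poc (a+1) n := by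
  rw [add_comm n 1, poc_add, poc_succ, poc_zero]; simp
lemma poc_ne_zero {c : ℂ} (hc : 0 < c.re) (n : ℕ) : poc c n ≠ 0 := by
  induction n with
  | zero => simp [poc_zero]
  | succ n ih =>
    rw [poc_succ]
    refine mul_ne_zero ih fun h => ?_
    have := congrArg Complex.re h
    simp at this
    have : (0:ℝ) ≤ n := n.cast_nonneg
    linarith
lemma poc_double (a : ℂ) (n : ℕ) : poc a (2*n) = 4^n * (poc (a/2) n * poc ((a+1)/2) n) := by
  induction n with
  | zero => simp [poc_zero]
  | succ n ih =>
    rw [show 2*(n+1) = 2*n+1+1 by ring, poc_succ, poc_succ, ih, poc_succ, poc_succ]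
    push_cast; ring
lemma poc_neg (b : ℂ) (n : ℕ) : poc (1 - b - n) n = (-1)^n * poc b n := by
  induction n with
  | zero => simp [poc_zero]
  | succ n ih =>
    rw [poc_succ_left, poc_succ]
    have : (1 - b - ((n+1 : ℕ):ℂ) + 1) = 1 - b - n := by push_cast; ring
    rw [this, ih]; push_cast; ring
lemma norm_poc_le (a : ℂ) (n : ℕ) : ‖poc a n‖ ≤ ‖poc (‖a‖ : ℂ) n‖ := by
  induction n with
  | zero => simp [poc_zero]
  | succ n ih =>
    rw [poc_succ, poc_succ, norm_mul, norm_mul]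
    gcongr
    have : ((‖a‖:ℂ) + n) = ((‖a‖ + n : ℝ) : ℂ) := by push_cast; rfl
    rw [this, Complex.norm_real, Real.norm_of_nonneg (by positivity)]
    exact (norm_add_le _ _).trans (by simp)
lemma poc_ofReal_nonneg (a : ℝ) (ha : 0 ≤ a) (n : ℕ) : poc (a:ℂ) n = (‖poc (a:ℂ) n‖ : ℂ) := by
  induction n with
  | zero => simp [poc_zero]
  | succ n ih =>
    have : ((a:ℂ) + n) = ((a + n : ℝ) : ℂ) := by push_cast; rfl
    rw [poc_succ, norm_mul, this, Complex.norm_real, Real.norm_of_nonneg (by positivity)]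
    conv_lhs => rw [ih]
    push_cast; rfl
lemma norm_poc_mono (a b : ℝ) (ha : 0 ≤ a) (hab : a ≤ b) (n : ℕ) :
    ‖poc (a:ℂ) n‖ ≤ ‖poc (b:ℂ) n‖ := by
  induction n with
  | zero => simp [poc_zero]
  | succ n ih =>
    rw [poc_succ, poc_succ, norm_mul, norm_mul]
    gcongr
    have h : ∀ a : ℝ, ((a:ℂ) + n) = ((a + n : ℝ) : ℂ) := by intro a; push_cast; rfl
    rw [h, h, Complex.norm_real, Real.norm_of_nonneg (by positivity), Complex.norm_real,
      Real.norm_of_nonneg (by have := ha.trans hab; positivity)]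
    linarith

noncomputable def co (a b c : ℂ) (n : ℕ) : ℂ := poc a n * poc b n / (n.factorial * poc c n)

noncomputable def gF (a b c x : ℂ) : ℂ := ∑' n, co a b c n * x ^ n

lemma co_eq (a b c : ℂ) : co a b c = ordinaryHypergeometricCoefficient a b c := by
  funext n
  simp only [co, ordinaryHypergeometricCoefficient, poc]
  field_simp

lemma gF_eq (a b c : ℂ) : gF a b c = ordinaryHypergeometric a b c := by
  funext x
  rw [ordinaryHypergeometric_eq_tsum]
  refine tsum_congr fun n => ?_
  rw [co_eq, ordinaryHypergeometricCoefficient, smul_eq_mul]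

lemma radius_ge (a b c : ℂ) : 1 ≤ (ordinaryHypergeometricSeries ℂ a b c).radius := by
  by_cases h : ∀ kn : ℕ, ↑kn ≠ -a ∧ ↑kn ≠ -b ∧ ↑kn ≠ -c
  · rw [ordinaryHypergeometricSeries_radius_eq_one _ _ _ _ h]
  · push Not at h
    obtain ⟨k, hk⟩ := h
    by_cases h1 : (k:ℂ) = -a
    · obtain rfl : a = -k := by rw [h1]; simp
      simp [ordinaryHypergeometric_radius_top_of_neg_nat₁]
    by_cases h2 : (k:ℂ) = -b
    · obtain rfl : b = -k := by rw [h2]; simp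
      simp [ordinaryHypergeometric_radius_top_of_neg_nat₂]
    have h3 := hk h1 h2
    obtain rfl : c = -k := by rw [h3]; simp
    simp [ordinaryHypergeometric_radius_top_of_neg_nat₃]

lemma hasFP (a b c : ℂ) :
    HasFPowerSeriesOnBall (gF a b c) (ordinaryHypergeometricSeries ℂ a b c) 0
      (ordinaryHypergeometricSeries ℂ a b c).radius := by
  rw [gF_eq]
  exact FormalMultilinearSeries.hasFPowerSeriesOnBall _
    (lt_of_lt_of_le one_pos (radius_ge a b c))

lemma co_summable (a b c : ℂ) (r : ℝ) (h0 : 0 ≤ r) (h1 : r < 1) :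
    Summable fun n => ‖co a b c n‖ * r ^ n := by
  lift r to NNReal using h0
  have := (ordinaryHypergeometricSeries ℂ a b c).summable_norm_mul_pow (r := r)
    (lt_of_lt_of_le (by exact_mod_cast h1) (radius_ge a b c))
  rw [co_eq]
  refine this.congr fun n => ?_
  rw [ordinaryHypergeometricSeries, FormalMultilinearSeries.ofScalars_norm]

lemma gF_hasSum (a b c x : ℂ) (hx : ‖x‖ < 1) :
    HasSum (fun n => co a b c n * x ^ n) (gF a b c x) := by
  apply Summable.hasSum
  apply Summable.of_norm
  simpa [norm_mul, norm_pow] using co_summable a b c ‖x‖ (norm_nonneg _) hx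

lemma gF_analyticAt (a b c x : ℂ) (hx : ‖x‖ < 1) : AnalyticAt ℂ (gF a b c) x := by
  apply (hasFP a b c).analyticAt_of_mem
  have := radius_ge a b c
  apply Metric.eball_subset_eball this
  rw [Metric.mem_eball, edist_zero_right, ← ofReal_norm, ENNReal.ofReal_lt_one]
  simpa using hx

lemma binom_hasSum (a x : ℂ) (hx : ‖x‖ < 1) :
    HasSum (fun n => poc a n / n.factorial * x ^ n) ((1 - x) ^ (-a)) := by
  have h := (Complex.one_add_cpow_hasFPowerSeriesOnBall_zero (a := -a)).hasSum (y := -x) (by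
    rw [Metric.mem_eball, edist_zero_right, ← ofReal_norm, ENNReal.ofReal_lt_one]; simpa using hx)
  simp only [zero_add] at h
  rw [← sub_eq_add_neg] at h
  convert! h using 2 with n
  simp only [binomialSeries_apply, Ring.choose_eq_smul, Polynomial.descPochhammer_smeval_eq_ascPochhammer,
    Polynomial.ascPochhammer_smeval_cast, Polynomial.ascPochhammer_smeval_eq_eval]
  have : -a - n + 1 = 1 - a - n := by ring
  rw [this]
  have := poc_neg a n
  rw [poc] at this
  rw [this]
  simp [neg_pow x]
  rw [div_eq_mul_inv]
  have : ((-1:ℂ)^n) * (-1)^n = 1 := by rw [← mul_pow]; simp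
  linear_combination (- poc a n * (n.factorial:ℂ)⁻¹ * x^n) * this

lemma chu (n : ℕ) : ∀ (e c : ℂ), 0 < c.re →
    ∑ ij ∈ Finset.HasAntidiagonal.antidiagonal n, ((n.choose ij.1 : ℂ)) * ((-1)^ij.1 * poc e ij.1 / poc c ij.1)
      = poc (c - e) n / poc c n := by
  induction n with
  | zero => intro e c hc; simp [poc_zero]
  | succ n ih =>
    intro e c hc
    have := Finset.sum_antidiagonal_choose_succ_mul (fun i _ => ((-1)^i * poc e i / poc c i)) n
    rw [this]
    have h1 := ih e c hc
    have h2 := ih (e+1) (c+1) (by simp; linarith)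
    have hc0 : c ≠ 0 := by rintro rfl; simp at hc
    have e1 : ∑ ij ∈ Finset.HasAntidiagonal.antidiagonal n, ((n.choose ij.1 : ℂ)) * ((-1)^(ij.1+1) * poc e (ij.1+1) / poc c (ij.1+1)) = -(e/c) * ∑ ij ∈ Finset.HasAntidiagonal.antidiagonal n, ((n.choose ij.1 : ℂ)) * ((-1)^ij.1 * poc (e+1) ij.1 / poc (c+1) ij.1) := by
      rw [Finset.mul_sum]
      refine Finset.sum_congr rfl fun ij _ => ?_
      rw [poc_succ_left, poc_succ_left]
      have := poc_ne_zero (c := c+1) (by simp; linarith) ij.1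
      field_simp
      ring
    have e2 : ∑ ij ∈ Finset.HasAntidiagonal.antidiagonal n, ((n.choose ij.2 : ℂ)) * ((-1)^(ij.1+1) * poc e (ij.1+1) / poc c (ij.1+1)) = ∑ ij ∈ Finset.HasAntidiagonal.antidiagonal n, ((n.choose ij.1 : ℂ)) * ((-1)^(ij.1+1) * poc e (ij.1+1) / poc c (ij.1+1)) := by
      refine Finset.sum_congr rfl fun ij h => ?_
      rw [Finset.HasAntidiagonal.mem_antidiagonal] at h
      rw [← h, Nat.choose_symm_add]
    rw [h1, e2, e1, h2]
    have q1 := poc_ne_zero (c := c+1) (by simp; linarith) n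
    have q2 := poc_ne_zero (c := c) hc n
    have q3 := poc_ne_zero (c := c) hc (n+1)
    have key : poc c n * (c + n) = c * poc (c+1) n := by rw [← poc_succ, poc_succ_left]
    have q4 : c + n ≠ 0 := by
      intro h; rw [h] at key; simp [hc0, q1] at key
    rw [show c + 1 - (e+1) = c - e by ring, poc_succ (c-e), poc_succ c]
    have : poc (c+1) n = poc c n * (c+n) / c := by rw [key]; field_simp
    rw [this]
    field_simp
    ring

set_option maxHeartbeats 2000000 in
lemma dbl (d : ℕ → ℂ) (a x : ℂ) (m : ℕ) (hx : ‖x‖ < 1)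
    (hd : Summable fun k => ‖d k‖ * (‖x‖ / (1 - ‖x‖) ^ m) ^ k) :
    HasSum (fun n => (∑ ij ∈ Finset.HasAntidiagonal.antidiagonal n,
        d ij.1 * (poc (a + (m * ij.1 : ℕ)) ij.2 / ij.2.factorial)) * x ^ n)
      ((1 - x) ^ (-a) * ∑' k, d k * (x / (1 - x) ^ m) ^ k) := by
  set g : ℕ × ℕ → ℂ := fun ij => d ij.1 * x ^ ij.1 *
    (poc (a + (m * ij.1 : ℕ)) ij.2 / ij.2.factorial * x ^ ij.2) with hg
  have hx1 : (0:ℝ) < 1 - ‖x‖ := by linarith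
  have h1x : 1 - x ≠ 0 := by
    intro h
    rw [sub_eq_zero] at h
    rw [← h] at hx; simp at hx
  -- inner sums
  have inner : ∀ k, HasSum (fun j => g (k, j))
      (d k * x ^ k * (1 - x) ^ (-(a + (m * k : ℕ)))) := fun k =>
    (binom_hasSum _ x hx).mul_left _
  have bnd : ∀ k, HasSum (fun j => ‖d k‖ * ‖x‖ ^ k *
      (‖poc ((‖a‖ + (m * k : ℕ) : ℝ) : ℂ) j‖ / j.factorial * ‖x‖ ^ j))
      (‖d k‖ * ‖x‖ ^ k * (1 - ‖x‖) ^ (-(‖a‖ + (m * k : ℕ)))) := by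
    intro k
    apply HasSum.mul_left
    have := binom_hasSum ((‖a‖ + (m * k : ℕ) : ℝ) : ℂ) (‖x‖ : ℂ) (by simpa using hx)
    rw [← Complex.hasSum_ofReal]
    convert! this using 2 with n
    · rw [poc_ofReal_nonneg _ (by positivity) n]
      push_cast
      simp
    · rw [Complex.ofReal_cpow hx1.le]; push_cast; rfl
  have norm_le : ∀ k j, ‖g (k, j)‖ ≤ ‖d k‖ * ‖x‖ ^ k *
      (‖poc ((‖a‖ + (m * k : ℕ) : ℝ) : ℂ) j‖ / j.factorial * ‖x‖ ^ j) := by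
    intro k j
    simp only [hg, norm_mul, norm_pow, norm_div, Complex.norm_natCast]
    gcongr
    refine (norm_poc_le _ _).trans (norm_poc_mono _ _ (norm_nonneg _) ?_ _)
    refine (norm_add_le _ _).trans ?_
    rw [Complex.norm_natCast]
  have sg : Summable g := by
    apply Summable.of_norm_bounded (g := fun ij : ℕ × ℕ => ‖d ij.1‖ * ‖x‖ ^ ij.1 *
      (‖poc ((‖a‖ + (m * ij.1 : ℕ) : ℝ) : ℂ) ij.2‖ / ij.2.factorial * ‖x‖ ^ ij.2)) _
      (fun ij => norm_le ij.1 ij.2)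
    rw [summable_prod_of_nonneg (fun ij => by positivity)]
    refine ⟨fun k => (bnd k).summable, ?_⟩
    refine (hd.mul_left ((1 - ‖x‖) ^ (-‖a‖))).congr fun k => ?_
    rw [(bnd k).tsum_eq, neg_add, Real.rpow_add hx1, Real.rpow_neg hx1.le (m * k : ℕ),
      Real.rpow_natCast, pow_mul, div_pow]
    field_simp
  have t1 : ∑' p, g p = (1 - x) ^ (-a) * ∑' k, d k * (x / (1 - x) ^ m) ^ k := by
    rw [sg.tsum_prod, ← tsum_mul_left]
    refine tsum_congr fun k => ?_
    rw [(inner k).tsum_eq, neg_add, Complex.cpow_add _ _ h1x, Complex.cpow_neg _ ((m*k : ℕ) : ℂ),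
      Complex.cpow_natCast, pow_mul, div_pow]
    field_simp
  rw [← t1]
  have h2 := (Finset.HasAntidiagonal.sigmaAntidiagonalEquivProd (A := ℕ)).hasSum_iff.mpr sg.hasSum
  have h3 := h2.sigma fun n => hasSum_fintype _
  convert! h3 using 2 with n
  rw [Finset.sum_mul]
  rw [← Finset.sum_coe_sort]
  refine Finset.sum_congr rfl fun ij _ => ?_
  have hn := Finset.HasAntidiagonal.mem_antidiagonal.mp ij.2
  simp only [Function.comp, Finset.HasAntidiagonal.sigmaAntidiagonalEquivProd_apply, hg]
  have hp : x ^ n = x ^ ij.1.1 * x ^ ij.1.2 := by rw [← pow_add, hn]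
  rw [hp]
  ring

lemma pfaff (a b c x : ℂ) (hc : 0 < c.re) (hx : ‖x‖ < 1 / 2) :
    gF a b c x = (1 - x) ^ (-a) * gF a (c - b) c (x / (x - 1)) := by
  have hr : ‖x‖ / (1 - ‖x‖) < 1 := by
    rw [div_lt_one (by linarith)]; linarith
  have hr0 : 0 ≤ ‖x‖ / (1 - ‖x‖) := div_nonneg (norm_nonneg _) (by linarith)
  have h := dbl (fun k => (-1) ^ k * co a (c - b) c k) a x 1 (by linarith) (by
    simpa using co_summable a (c - b) c _ hr0 hr)
  have e1 : ∑' k, (-1) ^ k * co a (c - b) c k * (x / (1 - x) ^ 1) ^ k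
      = gF a (c - b) c (x / (x - 1)) := by
    refine tsum_congr fun k => ?_
    have : x / (x - 1) = - (x / (1 - x) ^ 1) := by
      rw [pow_one, ← neg_sub 1 x, div_neg]
    rw [this, neg_pow (x / (1 - x) ^ 1)]
    ring
  rw [e1] at h
  rw [← h.tsum_eq, gF]
  refine tsum_congr fun n => ?_
  congr 1
  have hv := chu n (c - b) c hc
  rw [sub_sub_cancel] at hv
  have : co a b c n = poc a n / n.factorial * (poc b n / poc c n) := by
    rw [co]; have := poc_ne_zero hc n; field_simp
  rw [this, ← hv, Finset.mul_sum]
  refine Finset.sum_congr rfl fun ij hij => ?_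
  have hn := Finset.HasAntidiagonal.mem_antidiagonal.mp hij
  subst hn
  rw [Nat.choose_symm_add, Nat.add_choose, Nat.cast_div (Nat.factorial_mul_factorial_dvd_factorial_add _ _)
    (by exact_mod_cast mul_ne_zero (Nat.factorial_ne_zero _) (Nat.factorial_ne_zero _)), poc_add, co, one_mul]
  have := poc_ne_zero hc ij.1
  have f1 : (ij.1.factorial : ℂ) ≠ 0 := by exact_mod_cast Nat.factorial_ne_zero _
  have f2 : (ij.2.factorial : ℂ) ≠ 0 := by exact_mod_cast Nat.factorial_ne_zero _
  have f3 : ((ij.1 + ij.2).factorial : ℂ) ≠ 0 := by exact_mod_cast Nat.factorial_ne_zero _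
  push_cast
  field_simp

lemma quad_local (a c u : ℂ) (hc : 0 < c.re) (hx : ‖u‖ < 1 / 8) :
    gF a (a - c + 1) c u =
      (1 + u) ^ (-a) * gF (a / 2) ((a + 1) / 2) c (4 * u / (1 + u) ^ 2) := by
  have hr : 4 * ‖u‖ / (1 - ‖u‖) ^ 2 < 1 := by
    have := norm_nonneg u
    rw [div_lt_one (by nlinarith)]; nlinarith
  have hr0 : 0 ≤ 4 * ‖u‖ / (1 - ‖u‖) ^ 2 := by positivity
  have h := dbl (fun k => (-4) ^ k * co (a / 2) ((a + 1) / 2) c k) a (-u) 2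
    (by rw [norm_neg]; linarith) (by
    refine (co_summable (a / 2) ((a + 1) / 2) c _ hr0 hr).congr fun k => ?_
    simp only [norm_mul, norm_neg, norm_pow]
    rw [mul_div_assoc, mul_pow]
    have : ‖(4:ℂ)‖ = 4 := by simp
    rw [this]; ring)
  have e1 : ∑' k, (-4) ^ k * co (a / 2) ((a + 1) / 2) c k * (-u / (1 - -u) ^ 2) ^ k
      = gF (a / 2) ((a + 1) / 2) c (4 * u / (1 + u) ^ 2) := by
    refine tsum_congr fun k => ?_
    have : 4 * u / (1 + u) ^ 2 = (-4) * (-u / (1 - -u) ^ 2) := by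
      rw [sub_neg_eq_add]; ring
    rw [this, mul_pow (-4)]
    ring
  rw [e1, sub_neg_eq_add] at h
  rw [← h.tsum_eq, gF]
  refine tsum_congr fun n => ?_
  rw [neg_pow u, ← mul_assoc]
  congr 1
  have hv := chu n (a + n) c hc
  have q := poc_neg (a - c + 1) n
  rw [show 1 - (a - c + 1) - n = c - (a + n) by ring] at q
  rw [q] at hv
  have s1 : ((-1:ℂ)^n) * (-1)^n = 1 := by rw [← mul_pow]; simp
  have : co a (a - c + 1) c n =
      poc a n / n.factorial * ((-1) ^ n * poc (a - c + 1) n / poc c n) * (-1) ^ n := by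
    rw [co]; have := poc_ne_zero hc n
    have := Nat.factorial_ne_zero n
    rw [div_mul_div_comm, div_mul_eq_mul_div]
    congr 1
    linear_combination (-poc a n * poc (a - c + 1) n) * s1
  rw [this, ← hv, Finset.mul_sum]
  congr 1
  refine Finset.sum_congr rfl fun ij hij => ?_
  have hn := Finset.HasAntidiagonal.mem_antidiagonal.mp hij
  subst hn
  have k1 : poc a (ij.1 + ij.2) * poc (a + (ij.1 + ij.2 : ℕ)) ij.1
      = 4 ^ ij.1 * (poc (a / 2) ij.1 * poc ((a + 1) / 2) ij.1) * poc (a + (2 * ij.1 : ℕ)) ij.2 := by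
    rw [← poc_double, ← poc_add, ← poc_add]; congr 1; ring
  rw [Nat.choose_symm_add, Nat.add_choose, Nat.cast_div (Nat.factorial_mul_factorial_dvd_factorial_add _ _)
    (by exact_mod_cast mul_ne_zero (Nat.factorial_ne_zero _) (Nat.factorial_ne_zero _)), co, neg_pow (4:ℂ)]
  have := poc_ne_zero hc ij.1
  have f1 : (ij.1.factorial : ℂ) ≠ 0 := by exact_mod_cast Nat.factorial_ne_zero _
  have f2 : (ij.2.factorial : ℂ) ≠ 0 := by exact_mod_cast Nat.factorial_ne_zero _
  have f3 : ((ij.1 + ij.2).factorial : ℂ) ≠ 0 := by exact_mod_cast Nat.factorial_ne_zero _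
  rw [Nat.cast_mul (ij.1.factorial)]
  generalize poc a (ij.1 + ij.2) = A1 at *
  generalize poc (a + (ij.1 + ij.2 : ℕ)) ij.1 = A2 at *
  generalize poc (a + (2 * ij.1 : ℕ)) ij.2 = A3 at *
  field_simp
  linear_combination k1

lemma slit {x : ℂ} (hx : ‖x‖ < 1) : 1 - x ∈ Complex.slitPlane := by
  have := Complex.mem_slitPlane_of_norm_lt_one (z := -x) (by simpa using hx)
  simpa [sub_eq_add_neg] using this

lemma euler_local (a b c x : ℂ) (hc : 0 < c.re) (hx : ‖x‖ < 1 / 4) :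
    gF a b c x = (1 - x) ^ (c - a - b) * gF (c - a) (c - b) c x := by
  have hs := slit (x := x) (by linarith)
  have h0 : 1 - x ≠ 0 := Complex.slitPlane_ne_zero hs
  have h0' : x - 1 ≠ 0 := by rw [← neg_sub]; exact neg_ne_zero.mpr h0
  have hw : ‖x / (x - 1)‖ < 1 / 2 := by
    have : 1 - ‖x‖ ≤ ‖x - 1‖ := by
      rw [norm_sub_rev]; simpa using norm_sub_norm_le 1 x
    rw [norm_div, div_lt_iff₀ (by linarith)]
    linarith
  have sym : ∀ a b y, gF a b c y = gF b a c y := by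
    intro a b y; simp only [gF, co, mul_comm]
  rw [pfaff a b c x hc (by linarith), sym a, pfaff (c - b) a c _ hc hw, sym (c - b)]
  have w1 : 1 - x / (x - 1) = (1 - x)⁻¹ := by field_simp; ring
  have w2 : x / (x - 1) / (x / (x - 1) - 1) = x := by
    have : x / (x - 1) - 1 = (x - 1)⁻¹ := by field_simp; ring
    rw [this]; field_simp
  rw [w1, w2, Complex.inv_cpow _ _ (Complex.slitPlane_arg_ne_pi hs), ← Complex.cpow_neg,
    ← mul_assoc, ← Complex.cpow_add _ _ h0]
  congr 2
  ring

lemma euler (a b c x : ℂ) (hc : 0 < c.re) (hx : ‖x‖ < 1) :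
    gF a b c x = (1 - x) ^ (c - a - b) * gF (c - a) (c - b) c x := by
  have hU : IsPreconnected (Metric.ball (0:ℂ) 1) := (convex_ball _ _).isPreconnected
  have := AnalyticOnNhd.eqOn_of_preconnected_of_eventuallyEq (𝕜 := ℂ) (f := gF a b c)
    (g := fun x => (1 - x) ^ (c - a - b) * gF (c - a) (c - b) c x) (U := Metric.ball 0 1)
    (z₀ := 0) (fun y hy => gF_analyticAt _ _ _ _ (by simpa using hy))
    (fun y hy => by
      have hy : ‖y‖ < 1 := by simpa using hy
      refine AnalyticAt.mul ?_ (gF_analyticAt _ _ _ _ hy)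
      exact AnalyticAt.cpow (by fun_prop) (by fun_prop) (slit hy))
    hU (by simp) (by
      filter_upwards [Metric.ball_mem_nhds (0:ℂ) (by norm_num : (0:ℝ) < 1 / 4)] with y hy
      exact euler_local a b c y hc (by simpa using hy))
  exact this (by simpa using hx)

lemma quad (a c : ℂ) (u : ℝ) (hc : 0 < c.re) (hu : 0 ≤ u) (hu1 : u < 1) :
    gF a (a - c + 1) c u =
      (1 + u : ℂ) ^ (-a) * gF (a / 2) ((a + 1) / 2) c (4 * u / (1 + u) ^ 2) := by
  have hU : IsPreconnected (Complex.ofReal '' Ico (0:ℝ) 1) :=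
    isPreconnected_Ico.image _ Complex.continuous_ofReal.continuousOn
  have := AnalyticOnNhd.eqOn_of_preconnected_of_eventuallyEq (𝕜 := ℂ) (f := gF a (a - c + 1) c)
    (g := fun u => (1 + u) ^ (-a) * gF (a / 2) ((a + 1) / 2) c (4 * u / (1 + u) ^ 2))
    (U := Complex.ofReal '' Ico (0:ℝ) 1)
    (z₀ := 0) (fun y hy => by
      obtain ⟨v, ⟨hv0, hv1⟩, rfl⟩ := hy
      exact gF_analyticAt _ _ _ _ (by simpa [abs_of_nonneg hv0] using hv1))
    (fun y hy => by
      obtain ⟨v, ⟨hv0, hv1⟩, rfl⟩ := hy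
      have hne : (1 + (v:ℂ)) ≠ 0 := by
        have : (1 + (v:ℂ)) = ((1 + v : ℝ) : ℂ) := by push_cast; rfl
        rw [this]; exact_mod_cast (by positivity)
      refine AnalyticAt.mul ?_ ?_
      · refine AnalyticAt.cpow (by fun_prop) (by fun_prop) ?_
        left; simp; linarith
      · refine AnalyticAt.comp (g := gF (a / 2) ((a + 1) / 2) c)
          (f := fun u : ℂ => 4 * u / (1 + u) ^ 2) ?_ ?_
        · apply gF_analyticAt
          have : 4 * (v:ℂ) / (1 + v) ^ 2 = ((4 * v / (1 + v) ^ 2 : ℝ) : ℂ) := by push_cast; rfl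
          rw [this, Complex.norm_real, Real.norm_of_nonneg (by positivity),
            div_lt_one (by positivity)]
          nlinarith [mul_pos (sub_pos.2 hv1) (sub_pos.2 hv1)]
        · exact AnalyticAt.div (by fun_prop) (by fun_prop) (pow_ne_zero _ hne))
    hU ⟨0, by simp⟩ (by
      filter_upwards [Metric.ball_mem_nhds (0:ℂ) (by norm_num : (0:ℝ) < 1 / 8)] with y hy
      exact quad_local a c y hc (by simpa using hy))
  exact this ⟨u, ⟨hu, hu1⟩, rfl⟩

lemma reg_eq (a b c x : ℂ) (hc : 0 < c.re) :
    hyp2F1reg a b c x = gF a b c x / Complex.Gamma c := by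
  have hG : ∀ n : ℕ, Complex.Gamma (c + n) = poc c n * Complex.Gamma c := by
    intro n
    induction n with
    | zero => simp [poc_zero]
    | succ n ih =>
      push_cast
      rw [← add_assoc, Complex.Gamma_add_one, ih, poc_succ]
      · ring
      · intro h
        have := poc_ne_zero hc (n + 1)
        rw [poc_succ, h] at this
        simp at this
  rw [hyp2F1reg, gF, ← tsum_div_const]
  refine tsum_congr fun n => ?_
  rw [hG]
  change poc a n * poc b n / _ * _ = _
  rw [co]
  have := poc_ne_zero hc n
  have := Complex.Gamma_ne_zero_of_re_pos hc
  field_simp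

lemma Gamma_shift (p : ℂ) (hp : 0 < p.re) (n : ℕ) :
    Complex.Gamma (p + n) = poc p n * Complex.Gamma p := by
  induction n with
  | zero => simp [poc_zero]
  | succ n ih =>
    push_cast
    rw [← add_assoc, Complex.Gamma_add_one, ih, poc_succ]
    · ring
    · intro h
      have := poc_ne_zero hp (n + 1)
      rw [poc_succ, h] at this
      simp at this

lemma gegen_eq (lam α : ℂ) (hα : 0 < α.re) (w : ℝ) (hw : 1 < w) :
    gegenbauerC lam α w = (Real.sqrt Real.pi : ℂ) * Complex.Gamma (lam + 2 * α) /
      ((2 : ℂ) ^ (2 * α - 1) * Complex.Gamma α * Complex.Gamma (lam + 1)) /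
        Complex.Gamma (α + 1 / 2) * ((w : ℂ) ^ lam *
      gF (-lam / 2) ((-lam + 1) / 2) (α + 1 / 2) (1 - 1 / (w : ℂ) ^ 2)) := by
  have hc : 0 < (α + 1 / 2).re := by
    have : (1 / 2 : ℂ).re = 1 / 2 := by norm_num
    rw [Complex.add_re, this]; linarith
  rw [gegenbauerC, reg_eq _ _ _ _ hc]
  have hw1 : (0:ℝ) < w + 1 := by linarith
  have hq := quad (-lam) (α + 1 / 2) ((w - 1) / (w + 1)) hc
    (div_nonneg (by linarith) hw1.le) (by rw [div_lt_one hw1]; linarith)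
  rw [show -lam - (α + 1 / 2) + 1 = 1 / 2 - α - lam by ring] at hq
  have hwc : (w : ℂ) + 1 ≠ 0 := by exact_mod_cast hw1.ne'
  have hw0 : (w : ℂ) ≠ 0 := by
    have : w ≠ 0 := by linarith
    exact_mod_cast this
  have a1 : (1 + (((w - 1) / (w + 1) : ℝ) : ℂ)) = ((2 * w / (w + 1) : ℝ) : ℂ) := by
    push_cast; field_simp; ring
  have a2 : 4 * (((w - 1) / (w + 1) : ℝ) : ℂ) / (1 + (((w - 1) / (w + 1) : ℝ) : ℂ)) ^ 2
      = 1 - 1 / (w : ℂ) ^ 2 := by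
    rw [a1]; push_cast; field_simp; ring
  have a3 : (((w - 1) / (w + 1) : ℝ) : ℂ) = ((w : ℂ) - 1) / ((w : ℂ) + 1) := by push_cast; rfl
  rw [a2, a1, a3, neg_neg] at hq
  rw [hq]
  have a4 : ((w : ℂ) + 1) / 2 = (((w + 1) / 2 : ℝ) : ℂ) := by push_cast; rfl
  have a5 : (((w + 1) / 2 : ℝ) : ℂ) ^ lam * ((2 * w / (w + 1) : ℝ) : ℂ) ^ lam = (w : ℂ) ^ lam := by
    rw [← Complex.mul_cpow_ofReal_nonneg (by linarith)
      (div_nonneg (by linarith) hw1.le), ← Complex.ofReal_mul]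
    congr 2
    field_simp
  rw [a4, ← a5]
  ring

lemma beta_sum (p s c : ℂ) (hp : 0 < p.re) (hs : 0 < s.re) (hc : 0 < c.re) (T : ℝ)
    (hT : 0 ≤ T) (hT1 : T < 1) :
    ∫ v in Ioo (0:ℝ) 1, gF ((p + s) / 2) ((p + s + 1) / 2) c (((T * v) ^ 2 : ℝ) : ℂ) *
        ((v : ℂ) ^ (p - 1) * (1 - (v : ℂ)) ^ (s - 1)) =
      Complex.Gamma p * Complex.Gamma s / Complex.Gamma (p + s) *
        gF (p / 2) ((p + 1) / 2) c ((T ^ 2 : ℝ) : ℂ) := by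
  have hps : 0 < (p + s).re := by simp; linarith
  have hT2 : T ^ 2 < 1 := by nlinarith
  set a := (p + s) / 2
  set b := (p + s + 1) / 2
  set f : ℕ → ℝ → ℂ := fun k v => co a b c k * ((T ^ 2 : ℝ) : ℂ) ^ k *
    ((v : ℂ) ^ (p + (2 * k : ℕ) - 1) * (1 - (v : ℂ)) ^ (s - 1)) with hf
  have hpk : ∀ k : ℕ, 0 < (p + (2 * k : ℕ)).re := by
    intro k
    rw [Complex.add_re, Complex.natCast_re]; positivity
  have fint : ∀ k, IntegrableOn (f k) (Ioo 0 1) := by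
    intro k
    have := Complex.betaIntegral_convergent (hpk k) hs
    rw [intervalIntegrable_iff_integrableOn_Ioo_of_le zero_le_one] at this
    exact this.const_mul _
  have fval : ∀ k, ∫ v in Ioo (0:ℝ) 1, f k v = Complex.Gamma p * Complex.Gamma s /
      Complex.Gamma (p + s) * (co (p / 2) ((p + 1) / 2) c k * ((T ^ 2 : ℝ) : ℂ) ^ k) := by
    intro k
    simp only [hf]
    rw [integral_const_mul, ← integral_Ioc_eq_integral_Ioo,
      ← intervalIntegral.integral_of_le zero_le_one]
    change _ * Complex.betaIntegral (p + (2 * k : ℕ)) s = _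
    rw [Complex.betaIntegral_eq_Gamma_mul_div _ _ (hpk k) hs,
      show p + (2 * k : ℕ) + s = p + s + (2 * k : ℕ) by ring, Gamma_shift _ hp, Gamma_shift _ hps]
    have g1 := Complex.Gamma_ne_zero_of_re_pos hps
    have g2 := poc_ne_zero hps (2 * k)
    have g3 := poc_ne_zero hc k
    have d1 := poc_double p k
    have d2 := poc_double (p + s) k
    rw [d2] at g2
    rw [d1, d2, co, co]
    have g4 : poc a k ≠ 0 := by intro h; apply g2; simp [a] at h; simp [h]
    have g5 : poc b k ≠ 0 := by intro h; apply g2; simp [b] at h; simp [h]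
    change _ * (_ / ((4 ^ k * (poc a k * poc b k)) * _)) = _
    have f1 : (k.factorial : ℂ) ≠ 0 := by exact_mod_cast Nat.factorial_ne_zero _
    field_simp
  have hB : Summable fun k => ∫ v in Ioo (0:ℝ) 1, ‖f k v‖ := by
    set I0 := ∫ v in Ioo (0:ℝ) 1, ‖(v : ℂ) ^ (p - 1) * (1 - (v : ℂ)) ^ (s - 1)‖
    have i0 : IntegrableOn (fun v : ℝ => (v : ℂ) ^ (p - 1) * (1 - (v : ℂ)) ^ (s - 1)) (Ioo 0 1) := by
      have := Complex.betaIntegral_convergent hp hs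
      rwa [intervalIntegrable_iff_integrableOn_Ioo_of_le zero_le_one] at this
    refine Summable.of_nonneg_of_le (fun k => integral_nonneg fun v => norm_nonneg _) (fun k => ?_)
      ((co_summable a b c (T ^ 2) (by positivity) hT2).mul_right I0)
    rw [← integral_const_mul]
    refine setIntegral_mono_on (fint k).norm (i0.norm.const_mul _) measurableSet_Ioo fun v hv => ?_
    simp only [hf, norm_mul, norm_pow, Complex.norm_real]
    rw [Real.norm_of_nonneg hT]
    gcongr
    rw [Complex.norm_cpow_eq_rpow_re_of_pos hv.1, Complex.norm_cpow_eq_rpow_re_of_pos hv.1]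
    apply Real.rpow_le_rpow_of_exponent_ge hv.1 hv.2.le
    simp only [Complex.sub_re, Complex.add_re, Complex.natCast_re]
    have : (0:ℝ) ≤ (2 * k : ℕ) := by positivity
    linarith
  have key := hasSum_integral_of_summable_integral_norm fint hB
  have e : ∀ v ∈ Ioo (0:ℝ) 1, ∑' k, f k v = gF a b c (((T * v) ^ 2 : ℝ) : ℂ) *
        ((v : ℂ) ^ (p - 1) * (1 - (v : ℂ)) ^ (s - 1)) := by
    intro v hv
    rw [gF, ← tsum_mul_right]
    refine tsum_congr fun k => ?_
    simp only [hf]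
    have hv0 : (v : ℂ) ≠ 0 := by exact_mod_cast hv.1.ne'
    rw [show p + (2 * k : ℕ) - 1 = (p - 1) + (2 * k : ℕ) by ring, Complex.cpow_add _ _ hv0,
      Complex.cpow_natCast, pow_mul]
    push_cast
    rw [mul_pow, mul_pow]
    ring
  rw [← setIntegral_congr_fun measurableSet_Ioo e, ← key.tsum_eq]
  simp only [fval]
  rw [tsum_mul_left, gF]

lemma cpow_sq_half (X : ℝ) (hX : 0 < X) (b : ℂ) :
    ((X ^ 2 : ℝ) : ℂ) ^ (b / 2) = (X : ℂ) ^ b := by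
  have : b = b / 2 + b / 2 := by ring
  conv_rhs => rw [this]
  rw [Complex.cpow_add _ _ (by exact_mod_cast hX.ne'),
    ← Complex.mul_cpow_ofReal_nonneg hX.le hX.le, ← Complex.ofReal_mul, sq]

noncomputable def phi (T v : ℝ) : ℝ := (Real.sqrt (1 - (T * v) ^ 2))⁻¹

lemma phi_pos (T v : ℝ) (h : (T * v) ^ 2 < 1) : 0 < phi T v :=
  inv_pos.2 (Real.sqrt_pos.2 (by linarith))

lemma phi_sq (T v : ℝ) (h : (T * v) ^ 2 < 1) : phi T v ^ 2 * (1 - (T * v) ^ 2) = 1 := by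
  rw [phi, inv_pow, Real.sq_sqrt (by linarith)]
  exact inv_mul_cancel₀ (by linarith)

lemma phi_deriv (T v : ℝ) (h : (T * v) ^ 2 < 1) :
    HasDerivAt (phi T) (T ^ 2 * v * phi T v ^ 3) v := by
  have h1 : HasDerivAt (fun v : ℝ => 1 - (T * v) ^ 2) (-(2 * T ^ 2 * v)) v := by
    have := (((hasDerivAt_id v).const_mul T).pow 2).const_sub 1
    convert! this using 1
    simp; ring
  have h2 := (h1.sqrt (by linarith)).inv (Real.sqrt_ne_zero'.2 (by linarith))
  convert! h2 using 1
  have : 0 < Real.sqrt (1 - (T * v) ^ 2) := Real.sqrt_pos.2 (by linarith)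
  simp only [phi]
  field_simp

lemma phi_image (T z : ℝ) (hT : 0 < T) (hT1 : T < 1) (hz : 0 < z) (hzT : z ^ 2 * (1 - T ^ 2) = 1) :
    phi T '' Ioo 0 1 = Ioo 1 z ∧ InjOn (phi T) (Ioo 0 1) := by
  have hlt : ∀ v ∈ Ioo (0:ℝ) 1, (T * v) ^ 2 < T ^ 2 := by
    intro v hv
    have : T * v < T := by nlinarith [hv.2]
    have h0 : 0 < T * v := mul_pos hT hv.1
    nlinarith
  have hT2 : T ^ 2 < 1 := by nlinarith
  constructor
  · ext w
    constructor
    · rintro ⟨v, hv, rfl⟩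
      have h1 := hlt v hv
      have h2 := phi_pos T v (by linarith)
      have h3 := phi_sq T v (by linarith)
      have h0 : 0 < (T * v) ^ 2 := pow_pos (mul_pos hT hv.1) 2
      constructor
      · by_contra hcon
        push Not at hcon
        have : phi T v ^ 2 ≤ 1 := by nlinarith
        nlinarith
      · by_contra hcon
        push Not at hcon
        have h4 : z ^ 2 ≤ phi T v ^ 2 := by nlinarith
        have h5 : z ^ 2 * (1 - T ^ 2) ≤ phi T v ^ 2 * (1 - T ^ 2) :=
          mul_le_mul_of_nonneg_right h4 (by linarith)
        have h6 : phi T v ^ 2 * (1 - T ^ 2) < phi T v ^ 2 * (1 - (T * v) ^ 2) :=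
          mul_lt_mul_of_pos_left (by linarith) (by positivity)
        linarith
    · rintro ⟨hw1, hw2⟩
      have hw0 : 0 < w := by linarith
      have hww : w ^ 2 < z ^ 2 := by nlinarith
      have hw11 : 1 < w ^ 2 := by nlinarith
      set r := Real.sqrt (1 - (w ^ 2)⁻¹) with hr
      have hr2 : r ^ 2 = 1 - (w ^ 2)⁻¹ := Real.sq_sqrt (by
        rw [sub_nonneg]; exact inv_le_one_of_one_le₀ hw11.le)
      have hr0 : 0 < r := Real.sqrt_pos.2 (by
        rw [sub_pos]; exact inv_lt_one_of_one_lt₀ hw11)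
      have hrT : r < T := by
        have : T ^ 2 = 1 - (z ^ 2)⁻¹ := by field_simp; linarith
        have h5 : (z ^ 2)⁻¹ < (w ^ 2)⁻¹ := by gcongr
        nlinarith
      refine ⟨r / T, ⟨by positivity, by rw [div_lt_one hT]; exact hrT⟩, ?_⟩
      rw [phi, mul_div_cancel₀ _ hT.ne', hr2, sub_sub_cancel, Real.sqrt_inv, inv_inv,
        Real.sqrt_sq hw0.le]
  · intro v hv v' hv' h
    have h1 := phi_sq T v (by linarith [hlt v hv])
    have h2 := phi_sq T v' (by linarith [hlt v' hv'])
    have h3 := phi_pos T v (by linarith [hlt v hv])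
    rw [← h] at h2
    have h4 : phi T v ^ 2 ≠ 0 := by positivity
    have h5 : (T * v) ^ 2 = (T * v') ^ 2 := by
      have := mul_left_cancel₀ h4 (h1.trans h2.symm)
      linarith
    have h6 := (pow_left_inj₀ (mul_pos hT hv.1).le (mul_pos hT hv'.1).le two_ne_zero).1 h5
    exact mul_left_cancel₀ hT.ne' h6

lemma pointwise (lam p s : ℂ) (hsum : lam + p + s = 0) (W T V Z V1 : ℝ) (hW : 0 < W) (hT : 0 < T)
    (hV : 0 < V) (hZ : 0 < Z) (hV1 : 0 < V1) :
    ((T ^ 2 * V * W ^ 3 : ℝ) : ℂ) * ((W : ℂ) ^ lam * ((W * T * V : ℝ) : ℂ) ^ (p - 2) *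
      ((Z * W * T * V1 : ℝ) : ℂ) ^ (s - 1)) =
    (Z : ℂ) ^ (s - 1) * (T : ℂ) ^ (-lam - 1) * ((V : ℂ) ^ (p - 1) * (V1 : ℂ) ^ (s - 1)) := by
  have W0 : (W : ℂ) ≠ 0 := by exact_mod_cast hW.ne'
  have T0 : (T : ℂ) ≠ 0 := by exact_mod_cast hT.ne'
  have V0 : (V : ℂ) ≠ 0 := by exact_mod_cast hV.ne'
  rw [Complex.ofReal_mul (W * T), Complex.ofReal_mul W,
    Complex.ofReal_mul (Z * W * T), Complex.ofReal_mul (Z * W), Complex.ofReal_mul Z]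
  rw [← Complex.ofReal_mul W T, Complex.mul_cpow_ofReal_nonneg (by positivity) (by positivity),
    Complex.ofReal_mul W T, Complex.mul_cpow_ofReal_nonneg (by positivity) (by positivity)]
  rw [← Complex.ofReal_mul Z W, ← Complex.ofReal_mul (Z * W) T,
    Complex.mul_cpow_ofReal_nonneg (by positivity) (by positivity), Complex.ofReal_mul (Z * W) T,
    Complex.mul_cpow_ofReal_nonneg (by positivity) (by positivity), Complex.ofReal_mul Z W,
    Complex.mul_cpow_ofReal_nonneg (by positivity) (by positivity)]
  have w1 : (W : ℂ) ^ lam * (W : ℂ) ^ (p - 2) * (W : ℂ) ^ (s - 1) * (W : ℂ) ^ 3 = 1 := by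
    rw [← Complex.cpow_natCast (W : ℂ) 3, ← Complex.cpow_add _ _ W0, ← Complex.cpow_add _ _ W0,
      ← Complex.cpow_add _ _ W0]
    have : lam + (p - 2) + (s - 1) + ((3 : ℕ) : ℂ) = 0 := by push_cast; linear_combination hsum
    rw [this, Complex.cpow_zero]
  have t1 : (T : ℂ) ^ (p - 2) * (T : ℂ) ^ (s - 1) * (T : ℂ) ^ 2 = (T : ℂ) ^ (-lam - 1) := by
    rw [← Complex.cpow_natCast (T : ℂ) 2, ← Complex.cpow_add _ _ T0, ← Complex.cpow_add _ _ T0]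
    congr 1
    push_cast; linear_combination hsum
  have v1 : (V : ℂ) ^ (p - 2) * (V : ℂ) = (V : ℂ) ^ (p - 1) := by
    conv_lhs => rw [← Complex.cpow_one (V : ℂ), Complex.cpow_one (V : ℂ)]
    rw [show p - 1 = (p - 2) + 1 by ring, Complex.cpow_add _ _ V0, Complex.cpow_one]
  rw [← t1, ← v1]
  push_cast
  linear_combination ((Z : ℂ) ^ (s - 1) * ((T : ℂ) ^ (p - 2) * (T : ℂ) ^ (s - 1) * (T : ℂ) ^ 2) *
    ((V : ℂ) ^ (p - 2) * (V : ℂ)) * (V1 : ℂ) ^ (s - 1)) * w1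

lemma const_eq (lam α : ℂ) (h1 : 0 < (lam + 2 * α).re) (h2 : (lam + α).re < 0)
    (hre : lam.re < 0)
    (hlam : ∀ n : ℤ, lam ≠ (n : ℂ)) (h3 : ∀ n : ℕ, 2 * lam + 2 * α + 1 ≠ -(n : ℂ)) :
    Complex.sin (2 * (Real.pi : ℂ) * (lam + α)) * Complex.Gamma (2 * lam + 2 * α + 1) /
        (Complex.sin ((Real.pi : ℂ) * lam) * Complex.Gamma (lam + 1) *
          Complex.Gamma (lam + 2 * α)) *
      (Complex.Gamma (lam + 2 * α) * Complex.Gamma (-(2 * lam + 2 * α)) /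
        Complex.Gamma (-lam)) = 1 := by
  have pi0 : (Real.pi : ℂ) ≠ 0 := by exact_mod_cast Real.pi_ne_zero
  have a1 := Complex.Gamma_mul_Gamma_one_sub (-(2 * lam + 2 * α))
  have a2 := Complex.Gamma_mul_Gamma_one_sub (-lam)
  rw [show 1 - -(2 * lam + 2 * α) = 2 * lam + 2 * α + 1 by ring,
    show (Real.pi : ℂ) * -(2 * lam + 2 * α) = - (2 * (Real.pi : ℂ) * (lam + α)) by ring,
    Complex.sin_neg] at a1
  rw [show 1 - -lam = lam + 1 by ring, mul_neg, Complex.sin_neg] at a2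
  have g1 : Complex.Gamma (2 * lam + 2 * α + 1) ≠ 0 := Complex.Gamma_ne_zero h3
  have g2 : Complex.Gamma (lam + 1) ≠ 0 := Complex.Gamma_ne_zero fun m h => by
    apply hlam (-m - 1); push_cast; linear_combination h
  have g3 : Complex.Gamma (-lam) ≠ 0 := Complex.Gamma_ne_zero_of_re_pos (by simpa using hre)
  have g4 : Complex.Gamma (-(2 * lam + 2 * α)) ≠ 0 := Complex.Gamma_ne_zero_of_re_pos (by
    simp at h2 ⊢; linarith)
  have g5 := Complex.Gamma_ne_zero_of_re_pos h1
  have s1 : Complex.sin (2 * (Real.pi : ℂ) * (lam + α)) ≠ 0 := by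
    intro h; rw [h, neg_zero, div_zero] at a1; exact mul_ne_zero g4 g1 a1
  have s2 : Complex.sin ((Real.pi : ℂ) * lam) ≠ 0 := by
    intro h; rw [h, neg_zero, div_zero] at a2; exact mul_ne_zero g3 g2 a2
  have b1 : Complex.sin (2 * (Real.pi : ℂ) * (lam + α)) * Complex.Gamma (2 * lam + 2 * α + 1) *
      Complex.Gamma (-(2 * lam + 2 * α)) = -(Real.pi : ℂ) := by
    rw [mul_assoc, mul_comm (Complex.Gamma (2 * lam + 2 * α + 1)), a1]; field_simp
  have b2 : Complex.sin ((Real.pi : ℂ) * lam) * Complex.Gamma (lam + 1) * Complex.Gamma (-lam)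
      = -(Real.pi : ℂ) := by
    rw [mul_assoc, mul_comm (Complex.Gamma (lam + 1)), a2]; field_simp
  rw [div_mul_div_comm, div_eq_one_iff_eq (by positivity)]
  linear_combination Complex.Gamma (lam + 2 * α) * (b1 - b2)

/-- Integral representation for a single Gegenbauer function of
the first kind in the hyperbolic context. -/
theorem gegenbauerC_single_integral
    (lam α : ℂ) (h1 : 0 < (lam + 2 * α).re) (h2 : (lam + α).re < 0)
    (hlam : ∀ n : ℤ, lam ≠ (n : ℂ)) (h3 : ∀ n : ℕ, 2 * lam + 2 * α + 1 ≠ -(n : ℂ))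
    (z : ℝ) (hz : 1 < z)
    (F : ℝ → ℂ)
    (hF : ∀ w, F w = gegenbauerC lam α w *
        ((w ^ 2 - 1 : ℝ) : ℂ) ^ ((lam + 2 * α - 2) / 2) *
        ((2 * z ^ 2 * w ^ 2 - z ^ 2 - w ^ 2
            - 2 * z * w * Real.sqrt ((z ^ 2 - 1) * (w ^ 2 - 1)) : ℝ) : ℂ) ^
          (-(2 * lam + 2 * α + 1) / 2))
    (hint : IntegrableOn F (Ioo 1 z)) :
    gegenbauerC lam α z =
      Complex.sin (2 * (Real.pi : ℂ) * (lam + α)) * Complex.Gamma (2 * lam + 2 * α + 1) *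
          ((z ^ 2 - 1 : ℝ) : ℂ) ^ ((lam + 1) / 2) /
        (Complex.sin ((Real.pi : ℂ) * lam) * Complex.Gamma (lam + 1) *
          Complex.Gamma (lam + 2 * α)) *
        ∫ w in Ioo 1 z, F w := by
  have hαre : 0 < α.re := by simp at h1 h2; linarith
  have hre : lam.re < 0 := by simp at h1 h2; linarith
  have hc : 0 < (α + 1 / 2).re := by
    have : (1 / 2 : ℂ).re = 1 / 2 := by norm_num
    rw [Complex.add_re, this]; linarith
  have hz0 : 0 < z := by linarith
  have hzc : (z : ℂ) ≠ 0 := by exact_mod_cast hz0.ne'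
  have hz2 : 0 < z ^ 2 - 1 := by nlinarith
  set T := Real.sqrt (z ^ 2 - 1) / z with hTdef
  have hT : 0 < T := div_pos (Real.sqrt_pos.2 hz2) hz0
  have hzT2 : (z * T) ^ 2 = z ^ 2 - 1 := by
    rw [hTdef, mul_div_cancel₀ _ hz0.ne', Real.sq_sqrt hz2.le]
  have hzT : z ^ 2 * (1 - T ^ 2) = 1 := by nlinarith
  have hT1 : T < 1 := by
    have : 0 < 1 - T ^ 2 := by
      by_contra hcon
      push Not at hcon
      nlinarith [sq_nonneg z]
    nlinarith
  have hT2 : T ^ 2 < 1 := by nlinarith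
  obtain ⟨s, hs⟩ : ∃ s : ℂ, s = -(2 * lam + 2 * α) := ⟨_, rfl⟩
  have hsre : 0 < s.re := by simp [hs] at h2 ⊢; linarith
  set p : ℂ := lam + 2 * α with hp
  have hps : p + s = -lam := by rw [hp, hs]; ring
  obtain ⟨himg, hinj⟩ := phi_image T z hT hT1 hz0 hzT
  set K : ℂ := (Real.sqrt Real.pi : ℂ) * Complex.Gamma p /
      ((2 : ℂ) ^ (2 * α - 1) * Complex.Gamma α * Complex.Gamma (lam + 1)) /
        Complex.Gamma (α + 1 / 2) with hK
  have hlt : ∀ v ∈ Ioo (0:ℝ) 1, (T * v) ^ 2 < 1 := by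
    intro v hv
    have : T * v < 1 := by nlinarith [hv.2, hv.1]
    have h0 : 0 < T * v := mul_pos hT hv.1
    nlinarith
  have hI : ∫ w in Ioo 1 z, F w = K * ((z : ℂ) ^ (s - 1) * (T : ℂ) ^ (-lam - 1)) *
      (Complex.Gamma p * Complex.Gamma s / Complex.Gamma (-lam) *
        gF (p / 2) ((p + 1) / 2) (α + 1 / 2) ((T ^ 2 : ℝ) : ℂ)) := by
    rw [← hps, ← beta_sum p s (α + 1 / 2) h1 hsre hc T hT.le hT1, ← himg,
      integral_image_eq_integral_abs_deriv_smul measurableSet_Ioo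
        (fun v hv => (phi_deriv T v (hlt v hv)).hasDerivWithinAt) hinj, ← integral_const_mul]
    refine setIntegral_congr_fun measurableSet_Ioo fun v hv => ?_
    have hw0 := phi_pos T v (hlt v hv)
    have hw2 := phi_sq T v (hlt v hv)
    have hw1 : 1 < phi T v := by
      have : phi T v ∈ Ioo 1 z := by rw [← himg]; exact mem_image_of_mem _ hv
      exact this.1
    set w := phi T v with hw
    have hv0 := hv.1
    have hv1 : 0 < 1 - v := by linarith [hv.2]
    have c1 : w ^ 2 - 1 = (w * T * v) ^ 2 := by linear_combination hw2
    have c2 : Real.sqrt ((z ^ 2 - 1) * (w ^ 2 - 1)) = z * T * (w * T * v) := by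
      rw [c1, ← hzT2, ← mul_pow, Real.sqrt_sq (by positivity)]
    have c3 : 2 * z ^ 2 * w ^ 2 - z ^ 2 - w ^ 2
        - 2 * z * w * Real.sqrt ((z ^ 2 - 1) * (w ^ 2 - 1)) = (z * w * T * (1 - v)) ^ 2 := by
      rw [c2]
      linear_combination (-w ^ 2) * hzT2 + z ^ 2 * c1
    have c4 : 1 - 1 / (w : ℂ) ^ 2 = (((T * v) ^ 2 : ℝ) : ℂ) := by
      have : 1 - 1 / w ^ 2 = (T * v) ^ 2 := by
        field_simp; linear_combination hw2
      rw [← this]; push_cast; rfl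
    rw [hF, gegen_eq lam α hαre w hw1, c3, c1, c4, cpow_sq_half _ (by positivity),
      cpow_sq_half _ (by positivity), abs_of_pos (by positivity), Complex.real_smul]
    have pw := pointwise lam p s (by rw [hp, hs]; ring) w T v z (1 - v) hw0 hT hv0 hz0 hv1
    rw [show -(2 * lam + 2 * α + 1) = s - 1 by rw [hs]; ring, hps]
    rw [Complex.ofReal_sub 1 v, Complex.ofReal_one] at pw
    linear_combination (K * gF (-lam / 2) ((-lam + 1) / 2) (α + 1 / 2)
      (((T * v) ^ 2 : ℝ) : ℂ)) * pw
  have hconst := const_eq lam α h1 h2 hre hlam h3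
  rw [hI, gegen_eq lam α hαre z hz]
  have d1 : 1 - 1 / (z : ℂ) ^ 2 = ((T ^ 2 : ℝ) : ℂ) := by
    have : 1 - 1 / z ^ 2 = T ^ 2 := by
      field_simp; linear_combination hzT
    rw [← this]; push_cast; rfl
  have d2 := euler (p / 2) ((p + 1) / 2) (α + 1 / 2) ((T ^ 2 : ℝ) : ℂ) hc (by
    rw [Complex.norm_real, Real.norm_of_nonneg (by positivity)]; exact hT2)
  have d3 : (1 - ((T ^ 2 : ℝ) : ℂ)) = (((z ^ 2)⁻¹ : ℝ) : ℂ) := by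
    have : 1 - T ^ 2 = (z ^ 2)⁻¹ := by field_simp; linear_combination hzT
    rw [← this]; push_cast; rfl
  have d4 : (((z ^ 2)⁻¹ : ℝ) : ℂ) ^ (α + 1 / 2 - p / 2 - (p + 1) / 2) = (z : ℂ) ^ (-s) := by
    rw [← inv_pow, show α + 1 / 2 - p / 2 - (p + 1) / 2 = s / 2 by rw [hp, hs]; ring,
      cpow_sq_half _ (by positivity), Complex.ofReal_inv, Complex.inv_cpow, Complex.cpow_neg]
    rw [Complex.arg_ofReal_of_nonneg hz0.le]
    exact Real.pi_ne_zero.symm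
  have d5 : ((z ^ 2 - 1 : ℝ) : ℂ) ^ ((lam + 1) / 2) = (z : ℂ) ^ (lam + 1) * (T : ℂ) ^ (lam + 1) := by
    rw [← hzT2, cpow_sq_half _ (by positivity), Complex.ofReal_mul,
      Complex.mul_cpow_ofReal_nonneg hz0.le hT.le]
  have hTc : (T : ℂ) ≠ 0 := by exact_mod_cast hT.ne'
  have d6 : (T : ℂ) ^ (lam + 1) * (T : ℂ) ^ (-lam - 1) = 1 := by
    rw [← Complex.cpow_add _ _ hTc, show lam + 1 + (-lam - 1) = 0 by ring, Complex.cpow_zero]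
  have d7 : (z : ℂ) ^ (lam + 1) * (z : ℂ) ^ (s - 1) * (z : ℂ) ^ (-s) = (z : ℂ) ^ lam := by
    rw [← Complex.cpow_add _ _ hzc, ← Complex.cpow_add _ _ hzc]
    congr 1; ring
  have d8 : α + 1 / 2 - p / 2 = (-lam + 1) / 2 := by rw [hp]; ring
  have d9 : α + 1 / 2 - (p + 1) / 2 = -lam / 2 := by rw [hp]; ring
  have sym : ∀ a b c y, gF a b c y = gF b a c y := by
    intro a b c y; simp only [gF, co, mul_comm]
  rw [d3, d4, d8, d9, sym ((-lam + 1) / 2)] at d2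
  rw [d1, d2, d5, ← d7]
  generalize gF (-lam / 2) ((-lam + 1) / 2) (α + 1 / 2) ((T ^ 2 : ℝ) : ℂ) = H
  change K * _ = _
  rw [← hp, ← hs] at hconst
  generalize Complex.Gamma p * Complex.Gamma s / Complex.Gamma (-lam) = B at *
  generalize (z : ℂ) ^ (lam + 1) = z1 at *
  generalize (z : ℂ) ^ (s - 1) = z2 at *
  generalize (z : ℂ) ^ (-s) = z3 at *
  generalize (T : ℂ) ^ (lam + 1) = t1 at *
  generalize (T : ℂ) ^ (-lam - 1) = t2 at *
  rw [show ∀ a b c d e : ℂ, a * b * (c * d) / e = (a * b / e) * (c * d) from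
    fun a b c d e => by ring]
  generalize Complex.sin (2 * (Real.pi : ℂ) * (lam + α)) * Complex.Gamma (2 * lam + 2 * α + 1) /
        (Complex.sin ((Real.pi : ℂ) * lam) * Complex.Gamma (lam + 1) *
          Complex.Gamma p) = C at *
  linear_combination (-K * z1 * z2 * z3 * H) * hconst - (C * B * K * z1 * z2 * z3 * H) * d6
end
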